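/- If G is a graph with minimum degree δ(G) ≥ 2θ(G) − 1 and girth at least 6, then χ_o(G) ≤ 6θ(G), where θ(G) is the thickness of G. -/

import Mathlib

open SimpleGraph

/-- The degree of a vertex, as the cardinality of its neighbor set. -/
noncomputable def deg {V : Type} (G : SimpleGraph V) (v : V) : ℕ := (G.neighborSet v).ncard

/-- `H` is a minor of `G`, via branch sets. -/
def IsMinor {W V : Type} (H : SimpleGraph W) (G : SimpleGraph V) : Prop :=
  ∃ B : W → Set V,
    (∀ w, (B w).Nonempty) ∧
    (∀ w, (G.induce (B w)).Connected) ∧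
    (Pairwise fun w₁ w₂ => Disjoint (B w₁) (B w₂)) ∧
    (∀ w₁ w₂, H.Adj w₁ w₂ → ∃ v₁ ∈ B w₁, ∃ v₂ ∈ B w₂, G.Adj v₁ v₂)

/-- A graph is planar iff it has no `K₅` and no `K₃,₃` minor (Wagner's theorem). -/
def IsPlanar {V : Type} (G : SimpleGraph V) : Prop :=
  ¬ IsMinor (completeGraph (Fin 5)) G ∧
  ¬ IsMinor (completeBipartiteGraph (Fin 3) (Fin 3)) G

/-- `G` has thickness at most `t`: its edge set partitions into `t` planar subgraphs. -/
def ThicknessLE {V : Type} (G : SimpleGraph V) (t : ℕ) : Prop :=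
  ∃ c : Sym2 V → Fin t, ∀ i : Fin t,
    IsPlanar (SimpleGraph.fromEdgeSet {e | e ∈ G.edgeSet ∧ c e = i})

/-- The thickness of a graph. -/
noncomputable def thickness {V : Type} (G : SimpleGraph V) : ℕ :=
  sInf {t | ThicknessLE G t}

/-- `φ` is an odd coloring of `G` with `k` colors. -/
def IsOddColoring {V : Type} (G : SimpleGraph V) {k : ℕ} (φ : V → Fin k) : Prop :=
  (∀ ⦃u v⦄, G.Adj u v → φ u ≠ φ v) ∧
  ∀ v : V, (G.neighborSet v).Nonempty →
    ∃ c : Fin k, Odd ({u | u ∈ G.neighborSet v ∧ φ u = c}.ncard)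

/-- The odd chromatic number of `G`. -/
noncomputable def oddChrom {V : Type} (G : SimpleGraph V) : ℕ :=
  sInf {k | ∃ φ : V → Fin k, IsOddColoring G φ}

/-- `G` is odd `k⁺`-critical. -/
def OddCritical {V : Type} (G : SimpleGraph V) (k : ℕ) : Prop :=
  k ≤ oddChrom G ∧ ∀ H : G.Subgraph, H ≠ ⊤ → oddChrom H.coe < k

/-- A vertex is `n`-easy if its degree is odd or it has a neighbor of degree `2i`, `1 ≤ i ≤ n`. -/
def NEasy {V : Type} (G : SimpleGraph V) (n : ℕ) (v : V) : Prop :=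
  Odd (deg G v) ∨ ∃ u ∈ G.neighborSet v, ∃ i, 1 ≤ i ∧ i ≤ n ∧ deg G u = 2 * i

section Connectivity

open scoped Classical

variable {V : Type} {G : SimpleGraph V}

/-- The vertices of `K` induce a connected subgraph of `G`, phrased through cuts. -/
def ConnOn (G : SimpleGraph V) (K : Finset V) : Prop :=
  K.Nonempty ∧ ∀ A ⊆ K, A.Nonempty → A ≠ K → ∃ a ∈ A, ∃ b ∈ K, b ∉ A ∧ G.Adj a b

/-- Some edge of `G` joins the vertex sets `A` and `B`. -/
def Touch (G : SimpleGraph V) (A B : Finset V) : Prop := ∃ a ∈ A, ∃ b ∈ B, G.Adj a b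

theorem Touch.symm {A B : Finset V} (h : Touch G A B) : Touch G B A := by
  obtain ⟨a, ha, b, hb, h⟩ := h
  exact ⟨b, hb, a, ha, h.symm⟩

theorem Touch.mono {A B A' B' : Finset V} (h : Touch G A B) (hA : A ⊆ A') (hB : B ⊆ B') :
    Touch G A' B' := by
  obtain ⟨a, ha, b, hb, h⟩ := h
  exact ⟨a, hA ha, b, hB hb, h⟩

theorem connOn_singleton (v : V) : ConnOn G {v} := by
  refine ⟨by simp, fun A hA hne hA' => ?_⟩
  rcases Finset.subset_singleton_iff.1 hA with h | h
  · simp [h] at hne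
  · exact absurd h hA'

theorem ConnOn.union {K L : Finset V} (hK : ConnOn G K) (hL : ConnOn G L)
    (hKL : Touch G K L) : ConnOn G (K ∪ L) := by
  refine ⟨hK.1.mono Finset.subset_union_left, fun A hA hne hAne => ?_⟩
  by_contra hcon
  push Not at hcon
  have side : ∀ M : Finset V, M ⊆ K ∪ L → ConnOn G M → Disjoint A M ∨ M ⊆ A := by
    intro M hM hc
    by_contra h
    rw [not_or, Finset.not_disjoint_iff] at h
    obtain ⟨⟨x, hxA, hxM⟩, hn⟩ := h
    obtain ⟨a, ha, b, hb, hbA, hab⟩ := hc.2 (A ∩ M) Finset.inter_subset_right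
      ⟨x, by simp [hxA, hxM]⟩ (fun h => hn (by rw [← h]; exact Finset.inter_subset_left))
    rw [Finset.mem_inter] at ha hbA
    exact hcon a ha.1 b (hM hb) (fun h => hbA ⟨h, hb⟩) hab
  obtain ⟨k, hk, l, hl, hkl⟩ := hKL
  obtain ⟨x, hx⟩ := hne
  have hkU : k ∈ K ∪ L := Finset.mem_union_left _ hk
  have hlU : l ∈ K ∪ L := Finset.mem_union_right _ hl
  rcases side K Finset.subset_union_left hK with h1 | h1 <;>
    rcases side L Finset.subset_union_right hL with h2 | h2
  · rcases Finset.mem_union.1 (hA hx) with h | h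
    · exact Finset.disjoint_left.1 h1 hx h
    · exact Finset.disjoint_left.1 h2 hx h
  · exact hcon l (h2 hl) k hkU (fun h => Finset.disjoint_left.1 h1 h hk) hkl.symm
  · exact hcon k (h1 hk) l hlU (fun h => Finset.disjoint_left.1 h2 h hl) hkl
  · exact hAne (Finset.Subset.antisymm hA (Finset.union_subset h1 h2))

theorem ConnOn.insert_vertex {K : Finset V} (hK : ConnOn G K) {k v : V} (hk : k ∈ K)
    (hkv : G.Adj k v) : ConnOn G (insert v K) := by
  rw [Finset.insert_eq, Finset.union_comm]
  exact hK.union (connOn_singleton v) ⟨k, hk, v, by simp, hkv⟩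

/-- A connected subset of `R` extends to a connected component of `R`. -/
theorem ConnOn.exists_component {X R : Finset V} (hX : ConnOn G X) (hXR : X ⊆ R) :
    ∃ C, X ⊆ C ∧ C ⊆ R ∧ ConnOn G C ∧ ∀ a ∈ C, ∀ b ∈ R, G.Adj a b → b ∈ C := by
  obtain ⟨C, hC, hmax⟩ := (R.powerset.filter (fun C => X ⊆ C ∧ ConnOn G C)).exists_max_image
    Finset.card ⟨X, by simp [hXR, hX]⟩
  simp only [Finset.mem_filter, Finset.mem_powerset] at hC hmax
  refine ⟨C, hC.2.1, hC.1, hC.2.2, fun a ha b hb hab => ?_⟩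
  by_contra hbC
  have := hmax (insert b C) ⟨Finset.insert_subset hb hC.1,
    hC.2.1.trans (Finset.subset_insert _ _), hC.2.2.insert_vertex ha hab⟩
  rw [Finset.card_insert_of_notMem hbC] at this
  omega

/-- Two parts of a connected set are joined by an edge or by a connected set outside them. -/
theorem ConnOn.exists_link {Q P₁ P₂ : Finset V} (hQ : ConnOn G Q) (h₁ : P₁ ⊆ Q) (h₂ : P₂ ⊆ Q)
    (hn₁ : P₁.Nonempty) (hn₂ : P₂.Nonempty) (hd : Disjoint P₁ P₂) (hno : ¬ Touch G P₁ P₂) :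
    ∃ Y, ConnOn G Y ∧ Y ⊆ Q ∧ Disjoint Y P₁ ∧ Disjoint Y P₂ ∧ Touch G Y P₁ ∧ Touch G Y P₂ := by
  by_contra hcon
  push Not at hcon
  set R := Q \ (P₁ ∪ P₂) with hR
  set A := P₁ ∪ R.filter (fun r => ∃ Y, ConnOn G Y ∧ r ∈ Y ∧ Y ⊆ R ∧ Touch G Y P₁) with hA
  have hAP₂ : Disjoint A P₂ := by
    rw [Finset.disjoint_left]
    intro x hx hx2
    rw [hA, Finset.mem_union, Finset.mem_filter, hR] at hx
    rcases hx with h | h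
    · exact Finset.disjoint_left.1 hd h hx2
    · simp [hx2] at h
  obtain ⟨a, ha, b, hb, hbA, hab⟩ := hQ.2 A
    (Finset.union_subset h₁ ((Finset.filter_subset _ _).trans Finset.sdiff_subset))
    (hn₁.mono Finset.subset_union_left)
    (fun h => by
      obtain ⟨x, hx⟩ := hn₂
      exact Finset.disjoint_left.1 hAP₂ (h ▸ h₂ hx) hx)
  have hb1 : b ∉ P₁ := fun h => hbA (Finset.mem_union_left _ h)
  rw [hA, Finset.mem_union, Finset.mem_filter] at ha
  rcases ha with ha | ⟨haR, Y, hY, haY, hYR, hYP⟩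
  · by_cases hb2 : b ∈ P₂
    · exact hno ⟨a, ha, b, hb2, hab⟩
    · have hbR : b ∈ R := by simp [hR, hb, hb1, hb2]
      refine hbA (Finset.mem_union_right _ (Finset.mem_filter.2 ⟨hbR, {b}, connOn_singleton b,
        by simp, by simpa using hbR, b, by simp, a, ha, hab.symm⟩))
  · by_cases hb2 : b ∈ P₂
    · refine hcon Y hY (hYR.trans Finset.sdiff_subset) ?_ ?_ hYP ⟨a, haY, b, hb2, hab⟩ <;>
      · rw [Finset.disjoint_left]
        intro x hx hx'
        have := hYR hx
        simp [hR, hx'] at this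
    · have hbR : b ∈ R := by simp [hR, hb, hb1, hb2]
      exact hbA (Finset.mem_union_right _ (Finset.mem_filter.2 ⟨hbR, insert b Y,
        hY.insert_vertex haY hab, by simp, Finset.insert_subset hbR hYR,
        hYP.mono (Finset.subset_insert _ _) subset_rfl⟩))

theorem connOn_image_Ico (c : ℕ → V) (a b : ℕ) (hab : a < b)
    (hc : ∀ i, a ≤ i → i + 1 < b → G.Adj (c i) (c (i + 1))) :
    ConnOn G ((Finset.Ico a b).image c) := by
  induction b, hab using Nat.le_induction with
  | base => simpa using connOn_singleton (G := G) (c a)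
  | succ n hn ih =>
    have hn' : a < n := hn
    have := (ih fun i h1 h2 => hc i h1 (by omega)).insert_vertex (k := c (n - 1)) (v := c n)
      (Finset.mem_image_of_mem _ (by simp; omega)) (by
        have := hc (n - 1) (by omega) (by omega)
        rwa [Nat.sub_add_cancel (by omega)] at this)
    rwa [← Finset.image_insert, Finset.insert_Ico_right_eq_Ico_add_one (by omega)] at this

theorem connOn_of_induce_connected {K : Finset V} (h : (G.induce (K : Set V)).Connected) :
    ConnOn G K := by
  obtain ⟨⟨x, hx⟩⟩ := h.nonempty
  refine ⟨⟨x, hx⟩, fun A hA hne hAne => ?_⟩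
  by_contra hcon
  push Not at hcon
  obtain ⟨a, ha⟩ := hne
  have key : ∀ u v : (K : Set V), (G.induce (K : Set V)).Reachable u v → (u : V) ∈ A →
      (v : V) ∈ A := by
    rintro u v ⟨p⟩ hu
    induction p with
    | nil => exact hu
    | @cons u v w huv p ih =>
      refine ih ?_
      by_contra hv
      exact hcon u hu v v.2 hv huv
  refine hAne (Finset.Subset.antisymm hA fun b hb => ?_)
  exact key ⟨a, hA ha⟩ ⟨b, hb⟩ (h.preconnected _ _) ha

theorem ConnOn.induce_connected {K : Finset V} (h : ConnOn G K) :
    (G.induce (K : Set V)).Connected := by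
  obtain ⟨x, hx⟩ := h.1
  have : Nonempty (K : Set V) := ⟨⟨x, hx⟩⟩
  refine ⟨fun u v => ?_⟩
  by_contra hcon
  set A := K.filter (fun y => ∃ hy : y ∈ K, (G.induce (K : Set V)).Reachable u ⟨y, hy⟩) with hA
  obtain ⟨a, ha, b, hb, hbA, hab⟩ := h.2 A (Finset.filter_subset _ _)
    ⟨u, by
      rw [hA, Finset.mem_filter]
      exact ⟨u.2, u.2, SimpleGraph.Reachable.refl _⟩⟩
    (fun h => by
      have hv : (v : V) ∈ A := by
        rw [h]
        exact v.2
      rw [hA, Finset.mem_filter] at hv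
      exact hcon hv.2.2)
  rw [hA, Finset.mem_filter] at ha
  obtain ⟨-, haK, hr⟩ := ha
  refine hbA (Finset.mem_filter.2 ⟨hb, hb, hr.trans (SimpleGraph.Adj.reachable ?_)⟩)
  exact hab

theorem isMinor_of_connOn {W : Type} {H : SimpleGraph W} (B : W → Finset V)
    (hc : ∀ w, ConnOn G (B w)) (hd : ∀ w₁ w₂, w₁ ≠ w₂ → Disjoint (B w₁) (B w₂))
    (ht : ∀ w₁ w₂, H.Adj w₁ w₂ → Touch G (B w₁) (B w₂)) : IsMinor H G :=
  ⟨fun w => B w, fun w => (hc w).1, fun w => (hc w).induce_connected,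
    fun w₁ w₂ h => Finset.disjoint_coe.2 (hd w₁ w₂ h), fun w₁ w₂ h => ht w₁ w₂ h⟩

theorem IsMinor.exists_connOn [Fintype V] {W : Type} {H : SimpleGraph W} (h : IsMinor H G) :
    ∃ B : W → Finset V, (∀ w, ConnOn G (B w)) ∧
      (∀ w₁ w₂, w₁ ≠ w₂ → Disjoint (B w₁) (B w₂)) ∧
      ∀ w₁ w₂, H.Adj w₁ w₂ → Touch G (B w₁) (B w₂) := by
  obtain ⟨B, -, hc, hd, ht⟩ := h
  refine ⟨fun w => (B w).toFinset, fun w => connOn_of_induce_connected ?_,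
    fun w₁ w₂ h => Set.disjoint_toFinset.2 (hd h), fun w₁ w₂ h => ?_⟩
  · rw [Set.coe_toFinset]
    exact hc w
  · obtain ⟨a, ha, b, hb, hab⟩ := ht w₁ w₂ h
    exact ⟨a, by simpa using ha, b, by simpa using hb, hab⟩

theorem ConnOn.mono_graph {G' : SimpleGraph V} (hG : G ≤ G') {K : Finset V} (h : ConnOn G K) :
    ConnOn G' K := by
  refine ⟨h.1, fun A hA h1 h2 => ?_⟩
  obtain ⟨a, ha, b, hb, hbA, hab⟩ := h.2 A hA h1 h2
  exact ⟨a, ha, b, hb, hbA, hG hab⟩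

theorem IsPlanar.mono [Fintype V] {G' : SimpleGraph V} (hG : G ≤ G') (h : IsPlanar G') :
    IsPlanar G := by
  have key : ∀ {W : Type} (H : SimpleGraph W), IsMinor H G → IsMinor H G' := by
    intro W H hm
    obtain ⟨B, hc, hd, ht⟩ := hm.exists_connOn
    refine isMinor_of_connOn B (fun w => (hc w).mono_graph hG) hd fun w₁ w₂ hw => ?_
    obtain ⟨a, ha, b, hb, hab⟩ := ht w₁ w₂ hw
    exact ⟨a, ha, b, hb, hG hab⟩
  exact ⟨fun hm => h.1 (key _ hm), fun hm => h.2 (key _ hm)⟩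

/-- Six connected sets in the pattern of `K₃,₃`. -/
theorem IsPlanar.no_K33 (h : IsPlanar G) (A B : Fin 3 → Finset V)
    (hA : ∀ i, ConnOn G (A i)) (hB : ∀ i, ConnOn G (B i))
    (hAA : ∀ i j, i < j → Disjoint (A i) (A j)) (hBB : ∀ i j, i < j → Disjoint (B i) (B j))
    (hAB : ∀ i j, Disjoint (A i) (B j)) (ht : ∀ i j, Touch G (A i) (B j)) : False := by
  refine h.2 (isMinor_of_connOn (Sum.elim A B) ?_ ?_ ?_)
  · rintro (i | i)
    exacts [hA i, hB i]
  · rintro (i | i) (j | j) hij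
    · rcases lt_or_gt_of_ne (fun h => hij (congrArg _ h) : i ≠ j) with h | h
      exacts [hAA i j h, (hAA j i h).symm]
    · exact hAB i j
    · exact (hAB j i).symm
    · rcases lt_or_gt_of_ne (fun h => hij (congrArg _ h) : i ≠ j) with h | h
      exacts [hBB i j h, (hBB j i h).symm]
  · rintro (i | i) (j | j) hij
    · simp at hij
    · exact ht i j
    · exact (ht j i).symm
    · simp at hij

/-- Five connected sets in the pattern of `K₅`. -/
theorem IsPlanar.no_K5 (h : IsPlanar G) (A : Fin 5 → Finset V) (hA : ∀ i, ConnOn G (A i))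
    (hd : ∀ i j, i < j → Disjoint (A i) (A j)) (ht : ∀ i j, i < j → Touch G (A i) (A j)) :
    False := by
  refine h.1 (isMinor_of_connOn A hA (fun i j hij => ?_) fun i j hij => ?_)
  · rcases lt_or_gt_of_ne hij with h | h
    exacts [hd i j h, (hd j i h).symm]
  · rcases lt_or_gt_of_ne hij.ne with h | h
    exacts [ht i j h, (ht j i h).symm]

end Connectivity

section InducedCycles

open scoped Classical

variable {V : Type} {G : SimpleGraph V}

/-- `U` is the vertex set of an induced cycle of `G`. -/
def IsInducedCycle (G : SimpleGraph V) (U : Finset V) : Prop :=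
  ConnOn G U ∧ ∀ u ∈ U, (U.filter (G.Adj u)).card = 2

theorem IsInducedCycle.exists_param [Fintype V] {U : Finset V} (hU : IsInducedCycle G U) {a : V}
    (ha : a ∈ U) : ∃ (n : ℕ) (c : ℕ → V), 3 ≤ n ∧ c 0 = a ∧ c n = a ∧
      (Finset.Ico 0 n).image c = U ∧ (∀ i j, i < n → j < n → c i = c j → i = j) ∧
      ∀ i, i < n → G.Adj (c i) (c (i + 1)) := by
  set H : SimpleGraph V := SimpleGraph.mk (fun u v => u ∈ U ∧ v ∈ U ∧ G.Adj u v)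
    ⟨fun _ _ h => ⟨h.2.1, h.1, h.2.2.symm⟩⟩ ⟨fun _ h => G.loopless.irrefl _ h.2.2⟩ with hH
  have hnb : ∀ u ∈ U, H.neighborSet u = ↑(U.filter (G.Adj u)) := by
    intro u hu
    ext v
    simp [hH, hu]
  have hcyc : H.IsCycles := by
    rintro v ⟨w, hw⟩
    have hv : v ∈ U := hw.1
    rw [hnb v hv, Set.ncard_coe_finset, hU.2 v hv]
  have hne : (H.neighborSet a).Nonempty := by
    rw [hnb a ha, Finset.coe_nonempty, ← Finset.card_pos, hU.2 a ha]
    norm_num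
  obtain ⟨p, hp, hpv⟩ := hcyc.exists_cycle_toSubgraph_verts_eq_connectedComponentSupp
    (c := H.connectedComponentMk a) rfl hne
  have hsupp : ∀ v, v ∈ p.support ↔ v ∈ U := by
    intro v
    rw [← SimpleGraph.Walk.mem_verts_toSubgraph, hpv, SimpleGraph.ConnectedComponent.mem_supp_iff,
      SimpleGraph.ConnectedComponent.eq]
    constructor
    · rintro ⟨q⟩
      induction q with
      | nil => exact ha
      | cons h q _ => exact h.1
    · intro hv
      by_contra hcon
      set A := U.filter (fun y => H.Reachable a y) with hA
      obtain ⟨x, hx, b, hb, hbA, hxb⟩ := hU.1.2 A (Finset.filter_subset _ _)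
        ⟨a, by simp [hA, ha]⟩ (fun h => by
          have : v ∈ A := by rwa [h]
          rw [hA, Finset.mem_filter] at this
          exact hcon this.2.symm)
      rw [hA, Finset.mem_filter] at hx
      refine hbA (Finset.mem_filter.2 ⟨hb, hx.2.trans (SimpleGraph.Adj.reachable ?_)⟩)
      exact ⟨hx.1, hb, hxb⟩
  have h3 := hp.three_le_length
  refine ⟨p.length, p.getVert, h3, by simp, by simp, ?_, ?_, ?_⟩
  · ext v
    rw [← hsupp v, SimpleGraph.Walk.mem_support_iff_exists_getVert]
    simp only [Finset.mem_image, Finset.mem_Ico]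
    constructor
    · rintro ⟨i, hi, rfl⟩
      exact ⟨i, rfl, hi.2.le⟩
    · rintro ⟨i, rfl, hi⟩
      rcases hi.lt_or_eq with h | h
      · exact ⟨i, ⟨by omega, h⟩, rfl⟩
      · exact ⟨0, ⟨le_rfl, by omega⟩, by simp [h]⟩
  · intro i j hi hj hij
    exact hp.getVert_injOn' (by simp; omega) (by simp; omega) hij
  · intro i hi
    exact (p.adj_getVert_succ hi).2.2

theorem IsInducedCycle.eq_or_eq {U : Finset V} (hU : IsInducedCycle G U) {u a b v : V}
    (hu : u ∈ U) (ha : a ∈ U) (hb : b ∈ U) (hv : v ∈ U) (hab : a ≠ b) (hua : G.Adj u a)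
    (hub : G.Adj u b) (huv : G.Adj u v) : v = a ∨ v = b := by
  have h : ({a, b} : Finset V) = U.filter (G.Adj u) := by
    apply Finset.eq_of_subset_of_card_le
    · intro x hx
      rcases Finset.mem_insert.1 hx with rfl | hx
      · simp [ha, hua]
      · rw [Finset.mem_singleton] at hx
        subst hx
        simp [hb, hub]
    · rw [hU.2 u hu, Finset.card_pair hab]
  have hv : v ∈ ({a, b} : Finset V) := by
    rw [h]
    simp [hv, huv]
  simpa using hv

theorem IsInducedCycle.exists_two {U : Finset V} (hU : IsInducedCycle G U) {u : V} (hu : u ∈ U) :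
    ∃ a ∈ U, ∃ b ∈ U, a ≠ b ∧ G.Adj u a ∧ G.Adj u b := by
  obtain ⟨a, b, hab, h⟩ := Finset.card_eq_two.1 (hU.2 u hu)
  have ha : a ∈ U.filter (G.Adj u) := by simp [h]
  have hb : b ∈ U.filter (G.Adj u) := by simp [h]
  rw [Finset.mem_filter] at ha hb
  exact ⟨a, ha.1, b, hb.1, hab, ha.2, hb.2⟩

theorem IsInducedCycle.connOn_erase [Fintype V] {U : Finset V} (hU : IsInducedCycle G U) {a : V}
    (ha : a ∈ U) : ConnOn G (U.erase a) := by
  obtain ⟨n, c, hn, h0, -, hUc, hinj, hadj⟩ := hU.exists_param ha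
  have : U.erase a = (Finset.Ico 1 n).image c := by
    ext v
    rw [← hUc]
    simp only [Finset.mem_erase, Finset.mem_image, Finset.mem_Ico]
    constructor
    · rintro ⟨hv, i, hi, rfl⟩
      refine ⟨i, ⟨?_, hi.2⟩, rfl⟩
      by_contra hi0
      have : i = 0 := by omega
      exact hv (by rw [this, h0])
    · rintro ⟨i, hi, rfl⟩
      refine ⟨fun h => ?_, i, ⟨by omega, hi.2⟩, rfl⟩
      have := hinj i 0 hi.2 (by omega) (h.trans h0.symm)
      omega
  rw [this]
  exact connOn_image_Ico c 1 n (by omega) fun i _ hi => hadj i (by omega)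

/-- Two vertices of an induced cycle cut it into two arcs. -/
theorem IsInducedCycle.exists_arcs [Fintype V] {U : Finset V} (hU : IsInducedCycle G U) {a b : V}
    (ha : a ∈ U) (hb : b ∈ U) (hab : a ≠ b) :
    ∃ α β : Finset V, α ∪ β = U \ {a, b} ∧ Disjoint α β ∧ ¬ Touch G α β ∧
      (α.Nonempty ∨ β.Nonempty) ∧
      (α.Nonempty → ConnOn G α ∧ (∃ x ∈ α, G.Adj a x) ∧ ∃ x ∈ α, G.Adj b x) ∧
      (β.Nonempty → ConnOn G β ∧ (∃ x ∈ β, G.Adj a x) ∧ ∃ x ∈ β, G.Adj b x) ∧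
      (α = ∅ ∨ β = ∅ ↔ G.Adj a b) := by
  obtain ⟨n, c, hn, h0, hcn, hUc, hinj, hadj⟩ := hU.exists_param ha
  have hmem : ∀ i, i < n → c i ∈ U := fun i hi => by
    rw [← hUc]
    exact Finset.mem_image_of_mem _ (by simpa using hi)
  obtain ⟨j, hj, hjb⟩ : ∃ j, j < n ∧ c j = b := by
    rw [← hUc] at hb
    simpa using hb
  have hj0 : 0 < j := by
    rcases Nat.eq_zero_or_pos j with h | h
    · exact absurd (by rw [← h0, ← hjb, h]) hab
    · exact h
  have hmemI : ∀ p q i, (c i ∈ (Finset.Ico p q).image c) → i < n → q ≤ n → p ≤ i ∧ i < q := by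
    intro p q i h hi hq
    simp only [Finset.mem_image, Finset.mem_Ico] at h
    obtain ⟨k, hk, hki⟩ := h
    have := hinj k i (by omega) hi hki
    omega
  have hnbr : ∀ i k, 0 < i → i < n → k < n → G.Adj (c i) (c k) → k + 1 = i ∨ k = i + 1 ∨
      (i + 1 = n ∧ k = 0) := by
    intro i k hi0 hi hk hik
    have hadj' : G.Adj (c i) (c (i - 1)) := by
      have := hadj (i - 1) (by omega)
      rw [Nat.sub_add_cancel hi0] at this
      exact this.symm
    by_cases hin : i + 1 = n
    · have h2 : G.Adj (c i) (c 0) := by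
        have := hadj i hi
        rwa [hin, hcn, ← h0] at this
      rcases hU.eq_or_eq (hmem i hi) (hmem (i - 1) (by omega)) (hmem 0 (by omega)) (hmem k hk)
        (fun h => by have := hinj _ _ (by omega) (by omega) h; omega) hadj' h2 hik with h | h
      · have := hinj _ _ (by omega) (by omega) h
        omega
      · have := hinj _ _ (by omega) (by omega) h
        omega
    · rcases hU.eq_or_eq (hmem i hi) (hmem (i - 1) (by omega)) (hmem (i + 1) (by omega)) (hmem k hk)
        (fun h => by have := hinj _ _ (by omega) (by omega) h; omega) hadj' (hadj i hi) hik
        with h | h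
      · have := hinj _ _ (by omega) (by omega) h
        omega
      · have := hinj _ _ (by omega) (by omega) h
        omega
  have hne : ∀ p q, ((Finset.Ico p q).image c).Nonempty ↔ p < q := by
    intro p q
    simp
  refine ⟨(Finset.Ico 1 j).image c, (Finset.Ico (j + 1) n).image c, ?_, ?_, ?_, ?_, ?_, ?_, ?_⟩
  · ext v
    rw [← hUc]
    simp only [Finset.mem_union, Finset.mem_image, Finset.mem_Ico, Finset.mem_sdiff,
      Finset.mem_insert, Finset.mem_singleton, not_or]
    constructor
    · rintro (⟨i, hi, rfl⟩ | ⟨i, hi, rfl⟩) <;>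
      · refine ⟨⟨i, by omega, rfl⟩, fun h => ?_, fun h => ?_⟩
        · have := hinj i 0 (by omega) (by omega) (h.trans h0.symm)
          omega
        · have := hinj i j (by omega) (by omega) (h.trans hjb.symm)
          omega
    · rintro ⟨⟨i, hi, rfl⟩, h1, h2⟩
      have hi0 : i ≠ 0 := fun h => h1 (by rw [h, h0])
      have hij : i ≠ j := fun h => h2 (by rw [h, hjb])
      rcases lt_or_gt_of_ne hij with h | h
      · exact Or.inl ⟨i, by omega, rfl⟩
      · exact Or.inr ⟨i, by omega, rfl⟩
  · rw [Finset.disjoint_left]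
    intro x hx
    simp only [Finset.mem_image, Finset.mem_Ico] at hx
    obtain ⟨i, hi, rfl⟩ := hx
    intro h
    have := hmemI _ _ _ h (by omega) le_rfl
    omega
  · rintro ⟨x, hx, y, hy, hxy⟩
    simp only [Finset.mem_image, Finset.mem_Ico] at hx hy
    obtain ⟨i, hi, rfl⟩ := hx
    obtain ⟨k, hk, rfl⟩ := hy
    have := hnbr i k (by omega) (by omega) (by omega) hxy
    omega
  · rw [hne, hne]
    omega
  · rw [hne]
    intro h
    refine ⟨connOn_image_Ico c _ _ h fun i _ hi => hadj i (by omega),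
      ⟨c 1, Finset.mem_image_of_mem _ (by simpa using h), ?_⟩,
      ⟨c (j - 1), Finset.mem_image_of_mem _ (by simp; omega), ?_⟩⟩
    · rw [← h0]
      exact hadj 0 (by omega)
    · rw [← hjb]
      have := hadj (j - 1) (by omega)
      rw [Nat.sub_add_cancel hj0] at this
      exact this.symm
  · rw [hne]
    intro h
    refine ⟨connOn_image_Ico c _ _ h fun i _ hi => hadj i (by omega),
      ⟨c (n - 1), Finset.mem_image_of_mem _ (by simp; omega), ?_⟩,
      ⟨c (j + 1), Finset.mem_image_of_mem _ (by simpa using h), ?_⟩⟩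
    · have := hadj (n - 1) (by omega)
      rw [Nat.sub_add_cancel (by omega), hcn] at this
      exact this.symm
    · rw [← hjb]
      exact hadj j hj
  · rw [← Finset.not_nonempty_iff_eq_empty, ← Finset.not_nonempty_iff_eq_empty, hne, hne]
    constructor
    · rintro (h | h)
      · have : j = 1 := by omega
        rw [← h0, ← hjb, this]
        exact hadj 0 (by omega)
      · have := hadj j hj
        rw [show j + 1 = n by omega, hcn, hjb] at this
        exact this.symm
    · intro h
      rw [← h0, ← hjb] at h
      have := hnbr j 0 hj0 hj (by omega) h.symm
      omega

theorem IsInducedCycle.connOn_sdiff_pair [Fintype V] {U : Finset V} (hU : IsInducedCycle G U)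
    {x y : V} (hx : x ∈ U) (hy : y ∈ U) (hxy : G.Adj x y) :
    ConnOn G (U \ {x, y}) ∧ (∃ z ∈ U \ {x, y}, G.Adj x z) ∧ ∃ z ∈ U \ {x, y}, G.Adj y z := by
  obtain ⟨α, β, hun, -, -, hne, hα, hβ, h⟩ := hU.exists_arcs hx hy hxy.ne
  rw [← hun]
  rcases h.2 hxy with rfl | rfl
  · rw [Finset.empty_union]
    exact hβ (by simpa using hne)
  · rw [Finset.union_empty]
    exact hα (by simpa using hne)

end InducedCycles

section Peripheral

open scoped Classical

variable {V : Type} {G : SimpleGraph V}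

/-- `U` induces a cycle of `G` whose complement in `S` is connected. -/
def IsPeripheral (G : SimpleGraph V) (S U : Finset V) : Prop :=
  U ⊆ S ∧ IsInducedCycle G U ∧ ConnOn G (S \ U)

theorem IsInducedCycle.eq_of_subset {U W : Finset V} (hU : IsInducedCycle G U)
    (hW : IsInducedCycle G W) (h : U ⊆ W) : U = W := by
  by_contra hne
  obtain ⟨a, ha, b, hb, hbU, hab⟩ := hW.1.2 U h hU.1.1 hne
  obtain ⟨p, hp, q, hq, hpq, hap, haq⟩ := hU.exists_two ha
  rcases hW.eq_or_eq (h ha) (h hp) (h hq) hb hpq hap haq hab with rfl | rfl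
  exacts [hbU hp, hbU hq]

theorem ConnOn.exists_adjacent_extension {K X Y : Finset V} (hK : ConnOn G K) (hX : ConnOn G X)
    (hXK : X ⊆ K) (hYK : Y ⊆ K) (hY : Y.Nonempty) (hd : Disjoint X Y) :
    ∃ X', X ⊆ X' ∧ X' ⊆ K ∧ ConnOn G X' ∧ Disjoint X' Y ∧ Touch G X' Y := by
  obtain ⟨C, hXC, hCR, hC, hmax⟩ := hX.exists_component (R := K \ Y) (by
    intro x hx
    simp [hXK hx, Finset.disjoint_left.1 hd hx])
  have hCY : Disjoint C Y := by
    rw [Finset.disjoint_left]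
    intro x hx
    exact (Finset.mem_sdiff.1 (hCR hx)).2
  refine ⟨C, hXC, hCR.trans Finset.sdiff_subset, hC, hCY, ?_⟩
  obtain ⟨a, ha, b, hb, hbC, hab⟩ := hK.2 C (hCR.trans Finset.sdiff_subset) hC.1 (by
    rintro rfl
    obtain ⟨y, hy⟩ := hY
    exact Finset.disjoint_left.1 hCY (hYK hy) hy)
  refine ⟨a, ha, b, ?_, hab⟩
  by_contra hbY
  exact hbC (hmax a ha b (by simp [hb, hbY]) hab)

/-- In a planar graph, an induced cycle with connected complement has no two crossing bridges. -/
theorem IsPlanar.no_crossing (hpl : IsPlanar G) {S U W X α β : Finset V} {a b : V}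
    (hK : ConnOn G (S \ U)) (ha : a ∈ U) (hb : b ∈ U) (hab : a ≠ b)
    (hun : α ∪ β = U \ {a, b}) (hαβ : Disjoint α β) (hno : ¬ Touch G α β)
    (hα : ConnOn G α ∧ (∃ x ∈ α, G.Adj a x) ∧ ∃ x ∈ α, G.Adj b x)
    (hβ : ConnOn G β ∧ (∃ x ∈ β, G.Adj a x) ∧ ∃ x ∈ β, G.Adj b x)
    (hWS : W ⊆ S) (hαW : (α ∩ W).Nonempty) (hβW : (β ∩ W).Nonempty)
    (hQ : ConnOn G (W \ {a, b})) (hX : ConnOn G X) (hXS : X ⊆ S) (hXU : Disjoint X U)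
    (hXW : Disjoint X W) (hXa : Touch G X {a}) (hXb : Touch G X {b}) : False := by
  have hαU : α ⊆ U \ {a, b} := hun ▸ Finset.subset_union_left
  have hβU : β ⊆ U \ {a, b} := hun ▸ Finset.subset_union_right
  obtain ⟨Y, hY, hYQ, hY1, hY2, hYα, hYβ⟩ := hQ.exists_link (P₁ := α ∩ W) (P₂ := β ∩ W)
    (fun x hx => by
      have := hαU (Finset.mem_inter.1 hx).1
      rw [Finset.mem_sdiff] at this ⊢
      exact ⟨(Finset.mem_inter.1 hx).2, this.2⟩)
    (fun x hx => by
      have := hβU (Finset.mem_inter.1 hx).1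
      rw [Finset.mem_sdiff] at this ⊢
      exact ⟨(Finset.mem_inter.1 hx).2, this.2⟩) hαW hβW
    (hαβ.mono Finset.inter_subset_left Finset.inter_subset_left)
    (fun h => hno (h.mono Finset.inter_subset_left Finset.inter_subset_left))
  have hYU : Disjoint Y U := by
    rw [Finset.disjoint_left]
    intro y hy hyU
    have hyW := hYQ hy
    rw [Finset.mem_sdiff] at hyW
    have : y ∈ α ∪ β := by
      rw [hun, Finset.mem_sdiff]
      exact ⟨hyU, hyW.2⟩
    rcases Finset.mem_union.1 this with h | h
    · exact Finset.disjoint_left.1 hY1 hy (Finset.mem_inter.2 ⟨h, hyW.1⟩)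
    · exact Finset.disjoint_left.1 hY2 hy (Finset.mem_inter.2 ⟨h, hyW.1⟩)
  have hXY : Disjoint X Y := by
    rw [Finset.disjoint_left]
    intro x hx hxY
    exact Finset.disjoint_left.1 hXW hx (Finset.mem_sdiff.1 (hYQ hxY)).1
  obtain ⟨Z, hXZ, hZK, hZ, hZY, hZT⟩ := hK.exists_adjacent_extension hX
    (Y := Y) (fun x hx => Finset.mem_sdiff.2 ⟨hXS hx, Finset.disjoint_left.1 hXU hx⟩)
    (fun x hx => Finset.mem_sdiff.2 ⟨hWS (Finset.mem_sdiff.1 (hYQ hx)).1,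
      Finset.disjoint_left.1 hYU hx⟩) hY.1 hXY
  have hZU : Disjoint Z U := by
    rw [Finset.disjoint_left]
    intro x hx
    exact (Finset.mem_sdiff.1 (hZK hx)).2
  have tα : ∀ c, (∃ x ∈ α, G.Adj c x) → Touch G α {c} := fun c ⟨x, hx, h⟩ =>
    ⟨x, hx, c, by simp, h.symm⟩
  have tβ : ∀ c, (∃ x ∈ β, G.Adj c x) → Touch G β {c} := fun c ⟨x, hx, h⟩ =>
    ⟨x, hx, c, by simp, h.symm⟩
  have sα : α ⊆ U := hαU.trans Finset.sdiff_subset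
  have sβ : β ⊆ U := hβU.trans Finset.sdiff_subset
  have naα : a ∉ α := fun h => by simpa using hαU h
  have nbα : b ∉ α := fun h => by simpa using hαU h
  have naβ : a ∉ β := fun h => by simpa using hβU h
  have nbβ : b ∉ β := fun h => by simpa using hβU h
  have naZ : a ∉ Z := fun h => Finset.disjoint_left.1 hZU h ha
  have nbZ : b ∉ Z := fun h => Finset.disjoint_left.1 hZU h hb
  have naY : a ∉ Y := fun h => Finset.disjoint_left.1 hYU h ha
  have nbY : b ∉ Y := fun h => Finset.disjoint_left.1 hYU h hb
  refine hpl.no_K33 ![α, β, Z] ![{a}, {b}, Y] ?_ ?_ ?_ ?_ ?_ ?_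
  · intro i
    fin_cases i
    exacts [hα.1, hβ.1, hZ]
  · intro i
    fin_cases i
    exacts [connOn_singleton a, connOn_singleton b, hY]
  · intro i j hij
    fin_cases i <;> fin_cases j <;> simp at hij ⊢
    exacts [hαβ, (hZU.mono_right sα).symm, (hZU.mono_right sβ).symm]
  · intro i j hij
    fin_cases i <;> fin_cases j <;> simp at hij ⊢
    exacts [hab, naY, nbY]
  · intro i j
    fin_cases i <;> fin_cases j <;> simp
    exacts [naα, nbα, (hYU.mono_right sα).symm, naβ, nbβ, (hYU.mono_right sβ).symm, naZ, nbZ, hZY]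
  · intro i j
    fin_cases i <;> fin_cases j
    exacts [tα a hα.2.1, tα b hα.2.2, hYα.symm.mono Finset.inter_subset_left subset_rfl,
      tβ a hβ.2.1, tβ b hβ.2.2, hYβ.symm.mono Finset.inter_subset_left subset_rfl,
      hXa.mono hXZ subset_rfl, hXb.mono hXZ subset_rfl, hZT]

/-- Distinct peripheral cycles of a planar graph through an edge meet only in that edge. -/
theorem IsPeripheral.inter_subset [Fintype V] (hpl : IsPlanar G) {S U W : Finset V}
    (hdeg : ∀ v ∈ S, 3 ≤ (S.filter (G.Adj v)).card)
    (hU : IsPeripheral G S U) (hW : IsPeripheral G S W) (hne : U ≠ W) {x y z : V}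
    (hxU : x ∈ U) (hxW : x ∈ W) (hyU : y ∈ U) (hyW : y ∈ W) (hxy : G.Adj x y)
    (hzU : z ∈ U) (hzW : z ∈ W) : z = x ∨ z = y := by
  obtain ⟨hUS, hUc, hUK⟩ := hU
  obtain ⟨hWS, hWc, hWK⟩ := hW
  have hA : (U \ W).Nonempty := by
    rw [Finset.sdiff_nonempty]
    exact fun h => hne (hUc.eq_of_subset hWc h)
  have hAK : U \ W ⊆ S \ W := Finset.sdiff_subset_sdiff hUS subset_rfl
  -- a common vertex whose two neighbours on `U` are common vertices too
  have hcommon : ∀ m ∈ U, m ∈ W → ∀ p ∈ U, p ∈ W → ∀ q ∈ U, q ∈ W → p ≠ q → G.Adj m p →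
      G.Adj m q → False := by
    intro m hmU hmW p hpU hpW q hqU hqW hpq hmp hmq
    obtain ⟨b, hbS, hb⟩ : ∃ b ∈ S.filter (G.Adj m), b ∉ ({p, q} : Finset V) := by
      by_contra hcon
      push Not at hcon
      have h1 := Finset.card_le_card (show S.filter (G.Adj m) ⊆ {p, q} from hcon)
      have h2 := hdeg m (hUS hmU)
      rw [Finset.card_pair hpq] at h1
      omega
    rw [Finset.mem_filter] at hbS
    have hbp : ¬ (b = p ∨ b = q) := by simpa using hb
    have hbU : b ∉ U := fun h => hbp (hUc.eq_or_eq hmU hpU hqU h hpq hmp hmq hbS.2)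
    have hbW : b ∉ W := fun h => hbp (hWc.eq_or_eq hmW hpW hqW h hpq hmp hmq hbS.2)
    obtain ⟨X, hbX, hXR, hX, hmax⟩ := (connOn_singleton (G := G) b).exists_component
      (R := S \ (U ∪ W)) (by simp [hbS.1, hbU, hbW])
    have hXK : X ⊆ S \ W := hXR.trans (Finset.sdiff_subset_sdiff subset_rfl
      Finset.subset_union_right)
    have hXU : Disjoint X U := by
      rw [Finset.disjoint_left]
      intro v hv hvU
      simpa [hvU] using hXR hv
    have hXW : Disjoint X W := by
      rw [Finset.disjoint_left]
      intro v hv hvW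
      simpa [hvW] using hXR hv
    obtain ⟨u, hu, a, haK, haX, hua⟩ := hWK.2 X hXK hX.1 (by
      rintro rfl
      obtain ⟨v, hv⟩ := hA
      exact Finset.disjoint_left.1 hXU (hAK hv) (Finset.mem_sdiff.1 hv).1)
    rw [Finset.mem_sdiff] at haK
    have haU : a ∈ U := by
      by_contra h
      exact haX (hmax u hu a (by simp [haK.1, haK.2, h]) hua)
    have hma : m ≠ a := fun h => haK.2 (h ▸ hmW)
    obtain ⟨α, β, hun, hd, hno, -, hα, hβ, hadj⟩ := hUc.exists_arcs hmU haU hma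
    have hnadj : ¬ G.Adj m a := by
      intro h
      rcases hUc.eq_or_eq hmU hpU hqU haU hpq hmp hmq h with rfl | rfl
      exacts [haK.2 hpW, haK.2 hqW]
    rw [← hadj, not_or, ← Finset.not_nonempty_iff_eq_empty, ← Finset.not_nonempty_iff_eq_empty, not_not, not_not] at hnadj
    have hmeet : ∀ γ : Finset V, γ ⊆ α ∪ β → (∃ v ∈ γ, G.Adj m v) → (γ ∩ W).Nonempty := by
      rintro γ hγ ⟨v, hv, hmv⟩
      have hvU := hγ hv
      rw [hun, Finset.mem_sdiff] at hvU
      refine ⟨v, Finset.mem_inter.2 ⟨hv, ?_⟩⟩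
      rcases hUc.eq_or_eq hmU hpU hqU hvU.1 hpq hmp hmq hmv with rfl | rfl
      exacts [hpW, hqW]
    refine hpl.no_crossing hUK hmU haU hma hun hd hno (hα hnadj.1) (hβ hnadj.2) hWS
      (hmeet α Finset.subset_union_left (hα hnadj.1).2.1)
      (hmeet β Finset.subset_union_right (hβ hnadj.2).2.1) ?_ hX
      (hXR.trans Finset.sdiff_subset) hXU hXW ⟨b, hbX (by simp), m, by simp, hbS.2.symm⟩
      ⟨u, hu, a, by simp, hua⟩
    have : W \ {m, a} = W.erase m := by
      ext v
      simp only [Finset.mem_sdiff, Finset.mem_insert, Finset.mem_singleton, Finset.mem_erase,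
        not_or]
      constructor
      · exact fun h => ⟨h.2.1, h.1⟩
      · exact fun h => ⟨h.2, h.1, fun hva => haK.2 (hva ▸ h.2)⟩
    rw [this]
    exact hWc.connOn_erase hmW
  by_contra hcon
  rw [not_or] at hcon
  have hxz : x ≠ z := fun h => hcon.1 h.symm
  obtain ⟨α, β, hun, hd, hno, -, hα, hβ, hadj⟩ := hUc.exists_arcs hxU hzU hxz
  have hnadj : ¬ G.Adj x z := fun h =>
    hcommon x hxU hxW y hyU hyW z hzU hzW (fun h => hcon.2 h.symm) hxy h
  rw [← hadj, not_or, ← Finset.not_nonempty_iff_eq_empty, ← Finset.not_nonempty_iff_eq_empty, not_not, not_not] at hnadj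
  have hmeetA : ∀ γ δ : Finset V, γ ∪ δ = U \ {x, z} → ¬ Touch G γ δ → (∃ v ∈ γ, G.Adj x v) →
      (γ \ W).Nonempty := by
    rintro γ δ hγδ hnt ⟨t, ht, hxt⟩
    rw [Finset.sdiff_nonempty]
    intro hγW
    have htU : t ∈ U := (Finset.mem_sdiff.1 (hγδ ▸ Finset.mem_union_left δ ht)).1
    obtain ⟨p, hp, q, hq, hpq, htp, htq⟩ := hUc.exists_two htU
    have key : ∀ r ∈ U, G.Adj t r → r ∈ W := by
      intro r hr htr
      by_cases hrx : r = x
      · exact hrx ▸ hxW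
      by_cases hrz : r = z
      · exact hrz ▸ hzW
      have : r ∈ γ ∪ δ := by
        rw [hγδ]
        simp [hr, hrx, hrz]
      rcases Finset.mem_union.1 this with h | h
      · exact hγW h
      · exact absurd ⟨t, ht, r, h, htr⟩ hnt
    exact hcommon t htU (hγW ht) p hp (key p hp htp) q hq (key q hq htq) hpq htp htq
  have hA1 : (α \ W).Nonempty := hmeetA α β hun hno (hα hnadj.1).2.1
  have hA2 : (β \ W).Nonempty := hmeetA β α (by rw [Finset.union_comm, hun])
    (fun h => hno h.symm) (hβ hnadj.2).2.1
  have sα : α ⊆ U := (hun ▸ Finset.subset_union_left : α ⊆ U \ {x, z}).trans Finset.sdiff_subset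
  have sβ : β ⊆ U := (hun ▸ Finset.subset_union_right : β ⊆ U \ {x, z}).trans Finset.sdiff_subset
  have hAno : ¬ Touch G (α \ W) (β \ W) := fun h =>
    hno (h.mono Finset.sdiff_subset Finset.sdiff_subset)
  have hAsplit : ∀ v ∈ U, v ∉ W → v ∈ α \ W ∨ v ∈ β \ W := by
    intro v hv hvW
    have : v ∈ α ∪ β := by
      rw [hun]
      simp only [Finset.mem_sdiff, Finset.mem_insert, Finset.mem_singleton, not_or]
      exact ⟨hv, fun h => hvW (h ▸ hxW), fun h => hvW (h ▸ hzW)⟩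
    rcases Finset.mem_union.1 this with h | h
    · exact Or.inl (by simp [h, hvW])
    · exact Or.inr (by simp [h, hvW])
  obtain ⟨X, hX, hXK, hX1, hX2, ⟨u, hu, a, ha, hua⟩, ⟨v, hv, b, hb, hvb⟩⟩ := hWK.exists_link
    (P₁ := α \ W) (P₂ := β \ W) (Finset.sdiff_subset_sdiff (sα.trans hUS) subset_rfl)
    (Finset.sdiff_subset_sdiff (sβ.trans hUS) subset_rfl) hA1 hA2
    (hd.mono Finset.sdiff_subset Finset.sdiff_subset) hAno
  have hXW : Disjoint X W := by
    rw [Finset.disjoint_left]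
    exact fun t ht => (Finset.mem_sdiff.1 (hXK ht)).2
  have hXU : Disjoint X U := by
    rw [Finset.disjoint_left]
    intro t ht htU
    rcases hAsplit t htU (Finset.disjoint_left.1 hXW ht) with h | h
    · exact Finset.disjoint_left.1 hX1 ht h
    · exact Finset.disjoint_left.1 hX2 ht h
  have haU := sα (Finset.mem_sdiff.1 ha).1
  have hbU := sβ (Finset.mem_sdiff.1 hb).1
  have hab : a ≠ b := fun h => Finset.disjoint_left.1 hd (Finset.mem_sdiff.1 ha).1
    (h ▸ (Finset.mem_sdiff.1 hb).1)
  obtain ⟨γ, δ, hun', hd', hno', -, hγ, hδ, hadj'⟩ := hUc.exists_arcs haU hbU hab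
  have hnadj' : ¬ G.Adj a b := fun h => hAno ⟨a, ha, b, hb, h⟩
  rw [← hadj', not_or, ← Finset.not_nonempty_iff_eq_empty, ← Finset.not_nonempty_iff_eq_empty, not_not, not_not] at hnadj'
  have hmeetW : ∀ ε : Finset V, ε ⊆ γ ∪ δ → (ConnOn G ε ∧ (∃ x ∈ ε, G.Adj a x) ∧
      ∃ x ∈ ε, G.Adj b x) → (ε ∩ W).Nonempty := by
    rintro ε hε ⟨hεc, ⟨p, hp, hap⟩, ⟨q, hq, hbq⟩⟩
    by_contra hcon'
    rw [Finset.not_nonempty_iff_eq_empty, ← Finset.disjoint_iff_inter_eq_empty,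
      Finset.disjoint_left] at hcon'
    have hM := (hεc.insert_vertex hp hap.symm).insert_vertex (Finset.mem_insert_of_mem hq)
      hbq.symm
    have hMsub : ∀ t ∈ insert b (insert a ε), t ∈ U ∧ t ∉ W := by
      intro t ht
      rcases Finset.mem_insert.1 ht with rfl | ht
      · exact ⟨hbU, (Finset.mem_sdiff.1 hb).2⟩
      rcases Finset.mem_insert.1 ht with rfl | ht
      · exact ⟨haU, (Finset.mem_sdiff.1 ha).2⟩
      · have := hε ht
        rw [hun', Finset.mem_sdiff] at this
        exact ⟨this.1, hcon' ht⟩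
    obtain ⟨s, hs, t, ht, hts, hst⟩ := hM.2 (insert b (insert a ε) ∩ (α \ W))
      Finset.inter_subset_left ⟨a, by
        rw [Finset.mem_inter]
        exact ⟨by simp, ha⟩⟩ (fun h => by
        have : b ∈ insert b (insert a ε) ∩ (α \ W) := by
          rw [h]
          simp
        exact Finset.disjoint_left.1 hd
          (Finset.mem_sdiff.1 (Finset.mem_inter.1 this).2).1 (Finset.mem_sdiff.1 hb).1)
    obtain ⟨h1, h2⟩ := hMsub t ht
    rcases hAsplit t h1 h2 with h | h
    · exact hts (Finset.mem_inter.2 ⟨ht, h⟩)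
    · exact hAno ⟨s, (Finset.mem_inter.1 hs).2, t, h, hst⟩
  refine hpl.no_crossing hUK haU hbU hab hun' hd' hno' (hγ hnadj'.1) (hδ hnadj'.2) hWS
    (hmeetW γ Finset.subset_union_left (hγ hnadj'.1))
    (hmeetW δ Finset.subset_union_right (hδ hnadj'.2)) ?_ hX (hXK.trans Finset.sdiff_subset)
    hXU hXW ⟨u, hu, a, by simp, hua⟩ ⟨v, hv, b, by simp, hvb⟩
  have : W \ {a, b} = W := by
    rw [Finset.sdiff_eq_self_iff_disjoint, Finset.disjoint_left]
    intro t ht hta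
    rcases Finset.mem_insert.1 hta with rfl | h
    · exact (Finset.mem_sdiff.1 ha).2 ht
    · rw [Finset.mem_singleton] at h
      exact (Finset.mem_sdiff.1 hb).2 (h ▸ ht)
  rw [this]
  exact hWc.1

end Peripheral

section ThreePeripherals

open scoped Classical

variable {V : Type} {G : SimpleGraph V}

theorem ConnOn.union_of_mem {K L : Finset V} (hK : ConnOn G K) (hL : ConnOn G L) {v : V}
    (hvK : v ∈ K) (hvL : v ∈ L) : ConnOn G (K ∪ L) := by
  by_cases h : {v} = L
  · rw [← h, Finset.union_eq_left.2 (by simpa using hvK)]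
    exact hK
  · obtain ⟨a, ha, b, hb, -, hab⟩ := hL.2 {v} (by simpa using hvL) (by simp) h
    rw [Finset.mem_singleton] at ha
    exact hK.union hL ⟨v, hvK, b, hb, ha ▸ hab⟩

/-- Two disjoint connected parts of a connected set are joined by an edge or through the rest. -/
theorem ConnOn.exists_bridge {Q P₁ P₂ : Finset V} (hQ : ConnOn G Q) (h₁ : P₁ ⊆ Q) (h₂ : P₂ ⊆ Q)
    (hc₁ : ConnOn G P₁) (hc₂ : ConnOn G P₂) (hd : Disjoint P₁ P₂) :
    ∃ D, D ⊆ Q ∧ Disjoint D P₁ ∧ Disjoint D P₂ ∧ ConnOn G (P₁ ∪ D) ∧ Touch G (P₁ ∪ D) P₂ ∧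
      (D.Nonempty → ConnOn G D ∧ Touch G D P₁ ∧ Touch G D P₂) := by
  by_cases ht : Touch G P₁ P₂
  · exact ⟨∅, by simp, by simp, by simp, by simpa using hc₁, by simpa using ht, by simp⟩
  · obtain ⟨Y, hY, hYQ, hY1, hY2, ht1, ht2⟩ := hQ.exists_link h₁ h₂ hc₁.1 hc₂.1 hd ht
    exact ⟨Y, hYQ, hY1, hY2, hc₁.union hY ht1.symm,
      ht2.mono Finset.subset_union_right subset_rfl, fun _ => ⟨hY, ht1, ht2⟩⟩

/-- In a planar graph, three disjoint connected sets that touch both ends of an edge cannot be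
linked pairwise away from that edge. -/
theorem IsPlanar.no_three_links (hpl : IsPlanar G) {x y : V} (hxy : G.Adj x y)
    {P₁ P₂ P₃ D₁ D₂ D₃ : Finset V} (c₁ : ConnOn G P₁) (c₂ : ConnOn G P₂) (c₃ : ConnOn G P₃)
    (d₁₂ : Disjoint P₁ P₂) (d₁₃ : Disjoint P₁ P₃) (d₂₃ : Disjoint P₂ P₃)
    (nx₁ : x ∉ P₁) (nx₂ : x ∉ P₂) (nx₃ : x ∉ P₃) (ny₁ : y ∉ P₁) (ny₂ : y ∉ P₂) (ny₃ : y ∉ P₃)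
    (tx₁ : ∃ z ∈ P₁, G.Adj x z) (tx₂ : ∃ z ∈ P₂, G.Adj x z) (tx₃ : ∃ z ∈ P₃, G.Adj x z)
    (ty₁ : ∃ z ∈ P₁, G.Adj y z) (ty₂ : ∃ z ∈ P₂, G.Adj y z) (ty₃ : ∃ z ∈ P₃, G.Adj y z)
    (xD₁ : x ∉ D₁) (xD₂ : x ∉ D₂) (xD₃ : x ∉ D₃) (yD₁ : y ∉ D₁) (yD₂ : y ∉ D₂) (yD₃ : y ∉ D₃)
    (a₁ : Disjoint D₁ P₁) (b₁ : Disjoint D₁ P₂) (m₁ : Disjoint D₁ P₃)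
    (a₂ : Disjoint D₂ P₂) (b₂ : Disjoint D₂ P₃) (m₂ : Disjoint D₂ P₁)
    (a₃ : Disjoint D₃ P₃) (b₃ : Disjoint D₃ P₁) (m₃ : Disjoint D₃ P₂)
    (e₁ : ConnOn G (P₁ ∪ D₁)) (e₂ : ConnOn G (P₂ ∪ D₂)) (e₃ : ConnOn G (P₃ ∪ D₃))
    (f₁ : Touch G (P₁ ∪ D₁) P₂) (f₂ : Touch G (P₂ ∪ D₂) P₃) (f₃ : Touch G (P₃ ∪ D₃) P₁)
    (g₁ : D₁.Nonempty → ConnOn G D₁ ∧ Touch G D₁ P₁ ∧ Touch G D₁ P₂)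
    (g₂ : D₂.Nonempty → ConnOn G D₂ ∧ Touch G D₂ P₂ ∧ Touch G D₂ P₃)
    (g₃ : D₃.Nonempty → ConnOn G D₃ ∧ Touch G D₃ P₃ ∧ Touch G D₃ P₁) : False := by
  have hne := hxy.ne'
  have sing : ∀ {v : V} {P : Finset V}, (∃ z ∈ P, G.Adj v z) → Touch G {v} P :=
    fun {v} _ ⟨z, hz, h⟩ => ⟨v, by simp, z, hz, h⟩
  have nt : ∀ D : Finset V, ConnOn G D → Disjoint D P₁ → Disjoint D P₂ → Disjoint D P₃ →
      x ∉ D → y ∉ D → Touch G D P₁ → Touch G D P₂ → Touch G D P₃ → False := by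
    intro D hD i₁ i₂ i₃ hxD hyD t₁ t₂ t₃
    refine hpl.no_K33 ![{x}, {y}, D] ![P₁, P₂, P₃] ?_ ?_ ?_ ?_ ?_ ?_
    · simp [Fin.forall_fin_succ, connOn_singleton, hD]
    · simp [Fin.forall_fin_succ, c₁, c₂, c₃]
    · simp [Fin.forall_fin_succ, hxD, hyD, hne]
    · simp [Fin.forall_fin_succ, d₁₂, d₁₃, d₂₃]
    · simp [Fin.forall_fin_succ, *]
    · simp [Fin.forall_fin_succ, t₁, t₂, t₃, sing tx₁, sing tx₂, sing tx₃, sing ty₁, sing ty₂,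
        sing ty₃]
  have w₁₂ : Disjoint D₁ D₂ := by
    rw [Finset.disjoint_left]
    intro v hv hv'
    obtain ⟨k, ta, tb⟩ := g₁ ⟨v, hv⟩
    obtain ⟨k', -, tb'⟩ := g₂ ⟨v, hv'⟩
    exact nt (D₁ ∪ D₂) (k.union_of_mem k' hv hv') (by simp [*]) (by simp [*]) (by simp [*])
      (by simp [*]) (by simp [*]) (ta.mono Finset.subset_union_left subset_rfl)
      (tb.mono Finset.subset_union_left subset_rfl)
      (tb'.mono Finset.subset_union_right subset_rfl)
  have w₂₃ : Disjoint D₂ D₃ := by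
    rw [Finset.disjoint_left]
    intro v hv hv'
    obtain ⟨k, ta, tb⟩ := g₂ ⟨v, hv⟩
    obtain ⟨k', -, tb'⟩ := g₃ ⟨v, hv'⟩
    exact nt (D₂ ∪ D₃) (k.union_of_mem k' hv hv') (by simp [*]) (by simp [*]) (by simp [*])
      (by simp [*]) (by simp [*]) (tb'.mono Finset.subset_union_right subset_rfl)
      (ta.mono Finset.subset_union_left subset_rfl)
      (tb.mono Finset.subset_union_left subset_rfl)
  have w₁₃ : Disjoint D₁ D₃ := by
    rw [Finset.disjoint_left]
    intro v hv hv'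
    obtain ⟨k, ta, tb⟩ := g₁ ⟨v, hv⟩
    obtain ⟨k', ta', -⟩ := g₃ ⟨v, hv'⟩
    exact nt (D₁ ∪ D₃) (k.union_of_mem k' hv hv') (by simp [*]) (by simp [*]) (by simp [*])
      (by simp [*]) (by simp [*]) (ta.mono Finset.subset_union_left subset_rfl)
      (tb.mono Finset.subset_union_left subset_rfl)
      (ta'.mono Finset.subset_union_right subset_rfl)
  have up : ∀ {v : V} {P D : Finset V}, (∃ z ∈ P, G.Adj v z) → Touch G {v} (P ∪ D) := fun h =>
    (sing h).mono subset_rfl Finset.subset_union_left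
  have hxy' : Touch G {x} {y} := ⟨x, by simp, y, by simp, hxy⟩
  refine hpl.no_K5 ![{x}, {y}, P₁ ∪ D₁, P₂ ∪ D₂, P₃ ∪ D₃] ?_ ?_ ?_
  · simp [Fin.forall_fin_succ, connOn_singleton, e₁, e₂, e₃]
  · simp [Fin.forall_fin_succ, *, m₂.symm, b₃.symm, m₃.symm, b₁.symm]
  · simp [Fin.forall_fin_succ, up tx₁, up tx₂, up tx₃, up ty₁, up ty₂, up ty₃, hxy',
      f₁.mono subset_rfl Finset.subset_union_left, f₂.mono subset_rfl Finset.subset_union_left,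
      (f₃.mono subset_rfl Finset.subset_union_left).symm]

/-- In a planar graph of minimum degree at least three, no edge lies in three peripheral cycles. -/
theorem IsPeripheral.no_three [Fintype V] (hpl : IsPlanar G) {S U₁ U₂ U₃ : Finset V}
    (hdeg : ∀ v ∈ S, 3 ≤ (S.filter (G.Adj v)).card)
    (h₁ : IsPeripheral G S U₁) (h₂ : IsPeripheral G S U₂) (h₃ : IsPeripheral G S U₃)
    (h₁₂ : U₁ ≠ U₂) (h₁₃ : U₁ ≠ U₃) (h₂₃ : U₂ ≠ U₃) {x y : V} (hxy : G.Adj x y)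
    (hx₁ : x ∈ U₁) (hx₂ : x ∈ U₂) (hx₃ : x ∈ U₃)
    (hy₁ : y ∈ U₁) (hy₂ : y ∈ U₂) (hy₃ : y ∈ U₃) : False := by
  have key : ∀ {U W : Finset V}, IsPeripheral G S U → IsPeripheral G S W → U ≠ W → x ∈ U →
      x ∈ W → y ∈ U → y ∈ W → Disjoint (U \ {x, y}) W := by
    intro U W hU hW hne hxU hxW hyU hyW
    rw [Finset.disjoint_left]
    intro z hz hzW
    rw [Finset.mem_sdiff] at hz
    have := hU.inter_subset hpl hdeg hW hne hxU hxW hyU hyW hxy hz.1 hzW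
    exact hz.2 (by simpa using this)
  have hsub : ∀ U : Finset V, U \ {x, y} ⊆ U := fun U => Finset.sdiff_subset
  have d₁₂ := key h₁ h₂ h₁₂ hx₁ hx₂ hy₁ hy₂
  have d₁₃ := key h₁ h₃ h₁₃ hx₁ hx₃ hy₁ hy₃
  have d₂₁ := key h₂ h₁ h₁₂.symm hx₂ hx₁ hy₂ hy₁
  have d₂₃ := key h₂ h₃ h₂₃ hx₂ hx₃ hy₂ hy₃
  have d₃₁ := key h₃ h₁ h₁₃.symm hx₃ hx₁ hy₃ hy₁
  have d₃₂ := key h₃ h₂ h₂₃.symm hx₃ hx₂ hy₃ hy₂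
  obtain ⟨c₁, tx₁, ty₁⟩ := h₁.2.1.connOn_sdiff_pair hx₁ hy₁ hxy
  obtain ⟨c₂, tx₂, ty₂⟩ := h₂.2.1.connOn_sdiff_pair hx₂ hy₂ hxy
  obtain ⟨c₃, tx₃, ty₃⟩ := h₃.2.1.connOn_sdiff_pair hx₃ hy₃ hxy
  have eP : ∀ U : Finset V, x ∈ U → y ∈ U → ∀ D : Finset V, Disjoint D U →
      x ∉ D ∧ y ∉ D := fun U hx hy D hD =>
    ⟨fun h => Finset.disjoint_left.1 hD h hx, fun h => Finset.disjoint_left.1 hD h hy⟩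
  have hS : ∀ {U W : Finset V}, IsPeripheral G S U → Disjoint (U \ {x, y}) W →
      U \ {x, y} ⊆ S \ W := fun hU hd =>
    Finset.subset_sdiff.2 ⟨(hsub _).trans hU.1, hd⟩
  obtain ⟨D₁, q₁, a₁, b₁, e₁, f₁, g₁⟩ := h₃.2.2.exists_bridge (hS h₁ d₁₃) (hS h₂ d₂₃) c₁ c₂
    (d₁₂.mono_right (hsub _))
  obtain ⟨D₂, q₂, a₂, b₂, e₂, f₂, g₂⟩ := h₁.2.2.exists_bridge (hS h₂ d₂₁) (hS h₃ d₃₁) c₂ c₃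
    (d₂₃.mono_right (hsub _))
  obtain ⟨D₃, q₃, a₃, b₃, e₃, f₃, g₃⟩ := h₂.2.2.exists_bridge (hS h₃ d₃₂) (hS h₁ d₁₂) c₃ c₁
    (d₃₁.mono_right (hsub _))
  have z₁ : Disjoint D₁ U₃ := Finset.disjoint_of_subset_left q₁ Finset.sdiff_disjoint
  have z₂ : Disjoint D₂ U₁ := Finset.disjoint_of_subset_left q₂ Finset.sdiff_disjoint
  have z₃ : Disjoint D₃ U₂ := Finset.disjoint_of_subset_left q₃ Finset.sdiff_disjoint
  have y₁ := z₁.mono_right (hsub _)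
  have y₂ := z₂.mono_right (hsub _)
  have y₃ := z₃.mono_right (hsub _)
  obtain ⟨xD₁, yD₁⟩ := eP _ hx₃ hy₃ _ z₁
  obtain ⟨xD₂, yD₂⟩ := eP _ hx₁ hy₁ _ z₂
  obtain ⟨xD₃, yD₃⟩ := eP _ hx₂ hy₂ _ z₃
  exact hpl.no_three_links hxy c₁ c₂ c₃ (d₁₂.mono_right (hsub _)) (d₁₃.mono_right (hsub _))
    (d₂₃.mono_right (hsub _)) (by simp) (by simp) (by simp) (by simp) (by simp) (by simp)
    tx₁ tx₂ tx₃ ty₁ ty₂ ty₃ xD₁ xD₂ xD₃ yD₁ yD₂ yD₃ a₁ b₁ y₁ a₂ b₂ y₂ a₃ b₃ y₃ e₁ e₂ e₃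
    f₁ f₂ f₃ g₁ g₂ g₃

end ThreePeripherals

section Balance

open scoped Classical

variable {V : Type} {G : SimpleGraph V}

/-- `p` is a potential for the `ZMod 2`-labelling `φ` of the edges inside `W`. -/
def IsPotential (G : SimpleGraph V) (φ : Sym2 V → ZMod 2) (W : Finset V) (p : V → ZMod 2) : Prop :=
  ∀ u ∈ W, ∀ v ∈ W, G.Adj u v → φ s(u, v) = p u + p v

theorem zmod_two_eq_or (a b : ZMod 2) : a = b ∨ a = b + 1 := by
  decide +revert

theorem IsPotential.add_one {φ : Sym2 V → ZMod 2} {W : Finset V} {p : V → ZMod 2}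
    (h : IsPotential G φ W p) : IsPotential G φ W (fun v => p v + 1) := by
  intro u hu v hv huv
  rw [h u hu v hv huv]
  change _ = (p u + 1) + (p v + 1)
  generalize p u = a
  generalize p v = b
  decide +revert

theorem IsPotential.exists_unique_neighbor {φ : Sym2 V → ZMod 2} {W T : Finset V}
    (hT : 3 ≤ T.card)
    (hsep : ∀ Y ⊆ W, Y.Nonempty → Disjoint Y T → ∀ a b, ∃ y ∈ Y, ∃ v ∈ W, v ∉ Y ∧ v ≠ a ∧ v ≠ b ∧
      G.Adj y v)
    (hb : ∀ t ∈ T, ∃ p, IsPotential G φ (W.erase t) p)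
    (hn : ¬ ∃ p, IsPotential G φ W p) {t₁ : V} (ht₁ : t₁ ∈ T) (ht₁W : t₁ ∈ W)
    {p : V → ZMod 2} (hp : IsPotential G φ (W.erase t₁) p) :
    ∃ t ∈ T, t ≠ t₁ ∧ ∀ u ∈ W, (G.Adj t₁ u ∧ φ s(t₁, u) = p u) ↔ u = t := by
  have no_closed : ∀ L : Finset V, t₁ ∉ L → (∀ u ∈ W, G.Adj t₁ u → φ s(t₁, u) = p u → u ∈ L) →
      (∀ u ∈ L, G.Adj t₁ u → φ s(t₁, u) ≠ p u + 1) →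
      (∀ m ∈ L, ∀ v ∈ W, v ≠ t₁ → G.Adj m v → v ∈ L) → False := by
    intro L htL h0 h1 hc
    have at1 : ∀ u ∈ W, G.Adj t₁ u → φ s(t₁, u) = 1 + (p u + if u ∈ L then 1 else 0) := by
      intro u hu hadj
      by_cases huL : u ∈ L
      · have := (zmod_two_eq_or (φ s(t₁, u)) (p u)).resolve_right (h1 u huL hadj)
        rw [if_pos huL, this]
        generalize p u = a
        decide +revert
      · have := (zmod_two_eq_or (φ s(t₁, u)) (p u)).resolve_left
          (fun h => huL (h0 u hu hadj h))
        rw [if_neg huL, this]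
        generalize p u = a
        decide +revert
    refine hn ⟨fun v => if v = t₁ then 1 else p v + if v ∈ L then 1 else 0, ?_⟩
    intro u hu v hv huv
    by_cases hut : u = t₁
    · subst hut
      simp only [if_true, if_neg huv.ne']
      exact at1 v hv huv
    by_cases hvt : v = t₁
    · subst hvt
      simp only [if_true, if_neg huv.ne, Sym2.eq_swap (a := u)]
      rw [at1 u hu huv.symm, add_comm]
    · simp only [if_neg hut, if_neg hvt]
      rw [hp u (by simp [hu, hut]) v (by simp [hv, hvt]) huv]
      have : u ∈ L ↔ v ∈ L := ⟨fun h => hc u h v hv hvt huv, fun h => hc v h u hu hut huv.symm⟩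
      simp only [this]
      split_ifs <;> (generalize p u = a; generalize p v = b; decide +revert)
  let Valid : V → Finset V → Prop := fun t M => t ∈ T ∧ t ≠ t₁ ∧ t₁ ∉ M ∧ t ∉ M ∧ M ⊆ W ∧
    (∀ u ∈ W, u ≠ t → G.Adj t₁ u → φ s(t₁, u) = p u → u ∈ M) ∧
    (∀ u ∈ M, G.Adj t₁ u → φ s(t₁, u) ≠ p u + 1) ∧
    (∀ m ∈ M, ∀ v ∈ W, v ≠ t₁ → v ≠ t → G.Adj m v → v ∈ M)
  have hV : ∀ t ∈ T, t ≠ t₁ → ∃ M, Valid t M := by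
    intro t ht htt
    obtain ⟨q, hq⟩ := hb t ht
    refine ⟨W.filter fun u => u ≠ t₁ ∧ u ≠ t ∧ q u + p u = q t₁, ht, htt, by simp, by simp,
      Finset.filter_subset _ _, ?_, ?_, ?_⟩
    · intro u hu hut hadj h
      have := hq t₁ (by simp [ht₁W, htt.symm]) u (by simp [hu, hut]) hadj
      rw [Finset.mem_filter]
      refine ⟨hu, hadj.ne', hut, ?_⟩
      rw [h] at this
      rw [this]
      generalize q u = a
      generalize q t₁ = b
      decide +revert
    · intro u hu hadj h
      rw [Finset.mem_filter] at hu
      obtain ⟨hu, -, hut, hqp⟩ := hu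
      have := hq t₁ (by simp [ht₁W, htt.symm]) u (by simp [hu, hut]) hadj
      rw [h] at this
      revert this hqp
      generalize q u = a
      generalize q t₁ = b
      generalize p u = c
      decide +revert
    · intro m hm v hv hv1 hvt hmv
      rw [Finset.mem_filter] at hm ⊢
      obtain ⟨hm, hm1, hmt, hqp⟩ := hm
      refine ⟨hv, hv1, hvt, ?_⟩
      have e1 := hq m (by simp [hm, hmt]) v (by simp [hv, hvt]) hmv
      have e2 := hp m (by simp [hm, hm1]) v (by simp [hv, hv1]) hmv
      rw [e1] at e2
      revert e2 hqp
      generalize q m = a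
      generalize q t₁ = b
      generalize p m = c
      generalize q v = d
      generalize p v = e
      decide +revert
  obtain ⟨t₀, ht₀, ht₀1⟩ : ∃ t ∈ T, t ≠ t₁ := by
    by_contra hcon
    push Not at hcon
    have : T ⊆ {t₁} := fun t ht => by simpa using hcon t ht
    have := Finset.card_le_card this
    simp at this
    omega
  have hex : ∃ n, ∃ t M, Valid t M ∧ M.card = n := by
    obtain ⟨M, hM⟩ := hV t₀ ht₀ ht₀1
    exact ⟨_, t₀, M, hM, rfl⟩
  obtain ⟨t, M, hM, hcard⟩ := Nat.find_spec hex
  have hmin : ∀ s N, Valid s N → M.card ≤ N.card := fun s N hN => by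
    rw [hcard]
    exact Nat.find_min' hex ⟨s, N, hN, rfl⟩
  obtain ⟨htT, htt₁, ht₁M, htM, hMW, hM0, hM1, hMc⟩ := hM
  rcases M.eq_empty_or_nonempty with rfl | hMne
  · refine ⟨t, htT, htt₁, fun u hu => ⟨?_, ?_⟩⟩
    · rintro ⟨h1, h2⟩
      by_contra hut
      simpa using hM0 u hu hut h1 h2
    · rintro rfl
      by_contra hcon
      refine no_closed ∅ (by simp) ?_ (by simp) (by simp)
      intro v hv h1 h2
      by_cases hvu : v = u
      · exact absurd ⟨hvu ▸ h1, hvu ▸ h2⟩ hcon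
      · exact hM0 v hv hvu h1 h2
  exfalso
  obtain ⟨s, hsM, hsT⟩ : ∃ s ∈ M, s ∈ T := by
    by_contra hcon
    push Not at hcon
    obtain ⟨y, hy, v, hv, hvM, hv1, hvt, hyv⟩ :=
      hsep M hMW hMne (Finset.disjoint_left.2 hcon) t₁ t
    exact hvM (hMc y hy v hv hv1 hvt hyv)
  have hst₁ : s ≠ t₁ := fun h => ht₁M (h ▸ hsM)
  have hst : s ≠ t := fun h => htM (h ▸ hsM)
  obtain ⟨N, -, -, ht₁N, hsN, hNW, hN0, hN1, hNc⟩ := hV s hsT hst₁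
  by_cases htN : t ∈ N
  · refine no_closed (M ∪ N) (by simp [ht₁M, ht₁N]) ?_ ?_ ?_
    · intro u hu h1 h2
      rw [Finset.mem_union]
      by_cases hut : u = t
      · exact Or.inr (hut ▸ htN)
      · exact Or.inl (hM0 u hu hut h1 h2)
    · intro u hu
      rcases Finset.mem_union.1 hu with h | h
      exacts [hM1 u h, hN1 u h]
    · intro m hm v hv hv1 hmv
      rw [Finset.mem_union]
      rcases Finset.mem_union.1 hm with h | h
      · by_cases hvt : v = t
        · exact Or.inr (hvt ▸ htN)
        · exact Or.inl (hMc m h v hv hv1 hvt hmv)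
      · by_cases hvs : v = s
        · exact Or.inl (hvs ▸ hsM)
        · exact Or.inr (hNc m h v hv hv1 hvs hmv)
  · have hlt : (M ∩ N).card < M.card := Finset.card_lt_card ⟨Finset.inter_subset_left, fun h =>
      hsN (Finset.mem_inter.1 (h hsM)).2⟩
    refine absurd (hmin s (M ∩ N) ⟨hsT, hst₁, by simp [ht₁M], by simp [hsN],
      Finset.inter_subset_left.trans hMW, ?_, ?_, ?_⟩) (by omega)
    · intro u hu hus h1 h2
      have := hN0 u hu hus h1 h2
      exact Finset.mem_inter.2 ⟨hM0 u hu (fun h => htN (h ▸ this)) h1 h2, this⟩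
    · exact fun u hu => hM1 u (Finset.mem_inter.1 hu).1
    · intro m hm v hv hv1 hvs hmv
      rw [Finset.mem_inter] at hm
      have := hNc m hm.2 v hv hv1 hvs hmv
      exact Finset.mem_inter.2 ⟨hMc m hm.1 v hv hv1 (fun h => htN (h ▸ this)) hmv, this⟩

/-- If `φ` has a potential on `W` minus any terminal but not on `W`, then every terminal has
exactly two neighbors in `W`, and both are terminals. -/
theorem IsPotential.exists_two_neighbors {φ : Sym2 V → ZMod 2} {W T : Finset V}
    (hTW : T ⊆ W) (hT : 3 ≤ T.card)
    (hsep : ∀ Y ⊆ W, Y.Nonempty → Disjoint Y T → ∀ a b, ∃ y ∈ Y, ∃ v ∈ W, v ∉ Y ∧ v ≠ a ∧ v ≠ b ∧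
      G.Adj y v)
    (hb : ∀ t ∈ T, ∃ p, IsPotential G φ (W.erase t) p)
    (hn : ¬ ∃ p, IsPotential G φ W p) {t₁ : V} (ht₁ : t₁ ∈ T)
    {p : V → ZMod 2} (hp : IsPotential G φ (W.erase t₁) p) :
    ∃ a ∈ T, ∃ b ∈ T, a ≠ b ∧ φ s(t₁, a) = p a ∧ φ s(t₁, b) = p b + 1 ∧
      ∀ u ∈ W, G.Adj t₁ u ↔ u = a ∨ u = b := by
  obtain ⟨a, ha, -, hA⟩ := hp.exists_unique_neighbor hT hsep hb hn ht₁ (hTW ht₁)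
  obtain ⟨b, hb', -, hB⟩ := hp.add_one.exists_unique_neighbor hT hsep hb hn ht₁ (hTW ht₁)
  have hA' := (hA a (hTW ha)).2 rfl
  have hB' := (hB b (hTW hb')).2 rfl
  refine ⟨a, ha, b, hb', ?_, hA'.2, hB'.2, fun u hu => ⟨fun h => ?_, ?_⟩⟩
  · rintro rfl
    have := hA'.2.symm.trans hB'.2
    simp at this
  · rcases zmod_two_eq_or (φ s(t₁, u)) (p u) with h' | h'
    exacts [Or.inl ((hA u hu).1 ⟨h, h'⟩), Or.inr ((hB u hu).1 ⟨h, h'⟩)]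
  · rintro (rfl | rfl)
    exacts [hA'.1, hB'.1]

end Balance

section CycleSums

open scoped Classical

variable {V : Type} {G : SimpleGraph V}

/-- The edges of `G` with both ends in `U`. -/
noncomputable def edgesIn (G : SimpleGraph V) (U : Finset V) : Finset (Sym2 V) :=
  U.sym2.filter (· ∈ G.edgeSet)

/-- The sum of a vertex function over the ends of an edge. -/
noncomputable def coboundary {R : Type} [AddCommMonoid R] (p : V → R) (e : Sym2 V) : R :=
  ∑ v ∈ e.toFinset, p v

/-- Every vertex lies in an even number of edges of `F`. -/
def IsEvenSet (F : Finset (Sym2 V)) : Prop := ∀ v, Even (F.filter (v ∈ ·)).card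

theorem mk_mem_edgesIn {U : Finset V} {u v : V} :
    s(u, v) ∈ edgesIn G U ↔ u ∈ U ∧ v ∈ U ∧ G.Adj u v := by
  simp [edgesIn, and_assoc]

theorem coboundary_mk {R : Type} [AddCommMonoid R] (p : V → R) {u v : V} (h : u ≠ v) :
    coboundary p s(u, v) = p u + p v := by
  rw [coboundary, Sym2.toFinset_mk_eq, Finset.sum_pair h]

theorem sum_coboundary {R : Type} [AddCommMonoid R] [Fintype V] (F : Finset (Sym2 V)) (p : V → R) :
    ∑ e ∈ F, coboundary p e = ∑ v, (F.filter (v ∈ ·)).card • p v := by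
  simp only [coboundary]
  rw [Finset.sum_comm' (t' := Finset.univ) (s' := fun v => F.filter (v ∈ ·))]
  · simp
  · simp

theorem IsEvenSet.sum_coboundary_eq_zero [Fintype V] {F : Finset (Sym2 V)} (hF : IsEvenSet F)
    (p : V → ZMod 2) : ∑ e ∈ F, coboundary p e = 0 := by
  rw [sum_coboundary]
  refine Finset.sum_eq_zero fun v _ => ?_
  obtain ⟨k, hk⟩ := hF v
  rw [hk, add_nsmul, CharTwo.add_self_eq_zero]

theorem card_edgesIn_filter_mem {U : Finset V} {v : V} (hv : v ∈ U) :
    ((edgesIn G U).filter (v ∈ ·)).card = (U.filter (G.Adj v)).card := by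
  have : (edgesIn G U).filter (v ∈ ·) = (U.filter (G.Adj v)).image (fun w => s(v, w)) := by
    ext e
    simp only [Finset.mem_filter, Finset.mem_image]
    constructor
    · rintro ⟨he, hve⟩
      obtain ⟨w, rfl⟩ := Sym2.mem_iff_exists.1 hve
      rw [mk_mem_edgesIn] at he
      exact ⟨w, ⟨he.2.1, he.2.2⟩, rfl⟩
    · rintro ⟨w, ⟨hw, hvw⟩, rfl⟩
      exact ⟨mk_mem_edgesIn.2 ⟨hv, hw, hvw⟩, by simp⟩
  rw [this, Finset.card_image_of_injective]
  exact fun a b h => Sym2.congr_right.1 h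

theorem IsInducedCycle.isEvenSet {U : Finset V} (hU : IsInducedCycle G U) :
    IsEvenSet (edgesIn G U) := by
  intro v
  by_cases hv : v ∈ U
  · rw [card_edgesIn_filter_mem hv, hU.2 v hv]
    exact even_two
  · rw [Finset.filter_false_of_mem]
    · simp
    · intro e he hve
      obtain ⟨w, rfl⟩ := Sym2.mem_iff_exists.1 hve
      exact hv (mk_mem_edgesIn.1 he).1

theorem IsPotential.eq_coboundary {φ : Sym2 V → ZMod 2} {U : Finset V} {p : V → ZMod 2}
    (hp : IsPotential G φ U p) {e : Sym2 V} (he : e ∈ edgesIn G U) : φ e = coboundary p e := by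
  induction e with | _ u v
  rw [mk_mem_edgesIn] at he
  rw [coboundary_mk _ he.2.2.ne, hp u he.1 v he.2.1 he.2.2]

theorem IsPotential.sum_eq_zero [Fintype V] {φ : Sym2 V → ZMod 2} {U : Finset V} {p : V → ZMod 2}
    (hp : IsPotential G φ U p) (hU : IsInducedCycle G U) : ∑ e ∈ edgesIn G U, φ e = 0 := by
  rw [← hU.isEvenSet.sum_coboundary_eq_zero p]
  exact Finset.sum_congr rfl fun e he => hp.eq_coboundary he

/-- No two vertices separate `S`. -/
def NoTwoSep (G : SimpleGraph V) (S : Finset V) : Prop :=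
  ∀ Y ⊆ S, Y.Nonempty → ∀ a b, (∀ y ∈ Y, ∀ v ∈ S, G.Adj y v → v ∈ Y ∨ v = a ∨ v = b) →
    ∀ v ∈ S, v ∈ Y ∨ v = a ∨ v = b

theorem IsPotential.mono {φ : Sym2 V → ZMod 2} {U W : Finset V} {p : V → ZMod 2}
    (hp : IsPotential G φ W p) (h : U ⊆ W) : IsPotential G φ U p :=
  fun u hu v hv => hp u (h hu) v (h hv)

/-- A labelling with potentials on all `W.erase t` but not on `W` forces `W` to be connected. -/
theorem connOn_of_erase_potential {φ : Sym2 V → ZMod 2} {W : Finset V} (hW : W.Nonempty)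
    (hb : ∀ t ∈ W, ∃ p, IsPotential G φ (W.erase t) p) (hn : ¬ ∃ p, IsPotential G φ W p) :
    ConnOn G W := by
  refine ⟨hW, fun A hA ⟨a, ha⟩ hne => ?_⟩
  by_contra hcon
  push Not at hcon
  obtain ⟨b, hb', hbA⟩ : ∃ b ∈ W, b ∉ A := by
    by_contra h
    push Not at h
    exact hne (subset_antisymm hA h)
  obtain ⟨p, hp⟩ := hb b hb'
  obtain ⟨q, hq⟩ := hb a (hA ha)
  refine hn ⟨fun v => if v ∈ A then p v else q v, fun u hu v hv huv => ?_⟩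
  by_cases huA : u ∈ A
  · have hvA : v ∈ A := by
      by_contra h
      exact hcon u huA v hv h huv
    simp only [if_pos huA, if_pos hvA]
    exact hp u (by simp [hu]; rintro rfl; exact hbA huA) v
      (by simp [hv]; rintro rfl; exact hbA hvA) huv
  · have hvA : v ∉ A := fun h => hcon v h u hu huA huv.symm
    simp only [if_neg huA, if_neg hvA]
    exact hq u (by simp [hu]; rintro rfl; exact huA ha) v
      (by simp [hv]; rintro rfl; exact hvA ha) huv

theorem exists_subset_pair [Nonempty V] {s : Finset V} (h : s.card ≤ 2) :
    ∃ a b : V, s ⊆ {a, b} := by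
  rcases Nat.lt_or_ge s.card 2 with h' | h'
  · obtain ⟨a, ha⟩ := Finset.card_le_one_iff_subset_singleton.1 (Nat.lt_succ_iff.1 h')
    exact ⟨a, a, by simpa using ha⟩
  · obtain ⟨a, b, -, hab⟩ := Finset.card_eq_two.1 (le_antisymm h h')
    exact ⟨a, b, hab.le⟩

theorem exists_isPotential_of_peripheral [Fintype V] {S : Finset V}
    (hdeg : ∀ v ∈ S, 3 ≤ (S.filter (G.Adj v)).card) (hsep : NoTwoSep G S)
    {φ : Sym2 V → ZMod 2} (n : ℕ) :
    ∀ K ⊆ S, (K = ∅ ∨ ConnOn G K) → (S \ K).card = n →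
      (∀ U, IsPeripheral G S U → Disjoint U K → ∑ e ∈ edgesIn G U, φ e = 0) →
      ∃ p, IsPotential G φ (S \ K) p := by
  induction n with
  | zero =>
    intro K _ _ hn _
    rw [Finset.card_eq_zero] at hn
    exact ⟨0, by simp [hn, IsPotential]⟩
  | succ n ih =>
    intro K hKS hK hcard hφ
    set W := S \ K with hW
    have hWS : W ⊆ S := Finset.sdiff_subset
    have hWK : ∀ v ∈ W, v ∉ K := fun v hv => (Finset.mem_sdiff.1 hv).2
    let T := W.filter fun t => K = ∅ ∨ ∃ k ∈ K, G.Adj k t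
    have hTW : T ⊆ W := Finset.filter_subset _ _
    have hb : ∀ t ∈ T, ∃ p, IsPotential G φ (W.erase t) p := by
      intro t ht
      obtain ⟨htW, ht⟩ := Finset.mem_filter.1 ht
      have e : S \ insert t K = W.erase t := by
        ext v
        simp [hW]
        tauto
      rw [← e]
      refine ih (insert t K) (Finset.insert_subset (hWS htW) hKS) (Or.inr ?_) ?_ ?_
      · rcases hK with rfl | hK
        · exact connOn_singleton t
        · rcases ht with rfl | ⟨k, hk, hkt⟩
          · exact connOn_singleton t
          · exact hK.insert_vertex hk hkt
      · rw [e, Finset.card_erase_of_mem htW, hcard]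
        rfl
      · exact fun U hU hd => hφ U hU (hd.mono_right (Finset.subset_insert _ _))
    by_contra hn
    by_cases hW2 : W.card ≤ 2
    · obtain ⟨w, -⟩ : W.Nonempty := Finset.card_pos.1 (by omega)
      have : Nonempty V := ⟨w⟩
      obtain ⟨a, b, hab⟩ := exists_subset_pair hW2
      refine hn ⟨fun v => if v = a then φ s(a, b) else 0, fun u hu v hv huv => ?_⟩
      have hu' := hab hu
      have hv' := hab hv
      rw [Finset.mem_insert, Finset.mem_singleton] at hu' hv'
      rcases hu' with rfl | rfl <;> rcases hv' with rfl | rfl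
      · exact absurd rfl huv.ne
      · simp [huv.ne']
      · simp [huv.ne, Sym2.eq_swap (a := u)]
      · exact absurd rfl huv.ne
    push Not at hW2
    have hT : 3 ≤ T.card := by
      rcases hK with rfl | hK
      · have : T = W := Finset.filter_true_of_mem fun _ _ => Or.inl rfl
        rw [this]
        omega
      · by_contra hlt
        obtain ⟨a, b, hab⟩ : ∃ a b : V, T ⊆ {a, b} := by
          obtain ⟨k, -⟩ := hK.1
          have : Nonempty V := ⟨k⟩
          exact exists_subset_pair (by omega)
        have : W ⊆ {a, b} := by
          intro v hv
          have := hsep K hKS hK.1 a b (fun y hy v hv hyv => by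
            by_cases hvK : v ∈ K
            · exact Or.inl hvK
            · have : v ∈ T := Finset.mem_filter.2 ⟨Finset.mem_sdiff.2 ⟨hv, hvK⟩,
                Or.inr ⟨y, hy, hyv⟩⟩
              simpa using Or.inr (hab this)) v (hWS hv)
          simpa using this.resolve_left (hWK v hv)
        have := Finset.card_le_card this
        have := Finset.card_le_two (a := a) (b := b)
        omega
    have hsepH : ∀ Y ⊆ W, Y.Nonempty → Disjoint Y T → ∀ a b, ∃ y ∈ Y, ∃ v ∈ W, v ∉ Y ∧ v ≠ a ∧
        v ≠ b ∧ G.Adj y v := by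
      intro Y hY hne hd a b
      by_contra hcon
      push Not at hcon
      have hYT : ∀ y ∈ Y, K ≠ ∅ ∧ ∀ k ∈ K, ¬ G.Adj k y := by
        intro y hy
        have : y ∉ T := Finset.disjoint_left.1 hd hy
        simpa [T, hY hy] using this
      have key := hsep Y (hY.trans hWS) hne a b (fun y hy v hv hyv => by
        by_contra h
        push Not at h
        have hvK : v ∉ K := fun hvK => (hYT y hy).2 v hvK hyv.symm
        exact hcon y hy v (Finset.mem_sdiff.2 ⟨hv, hvK⟩) h.1 h.2.1 h.2.2 hyv)
      have : T ⊆ {a, b} := fun t ht => by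
        simpa using (key t (hWS (hTW ht))).resolve_left (Finset.disjoint_right.1 hd ht)
      have := Finset.card_le_card this
      have := Finset.card_le_two (a := a) (b := b)
      omega
    have htwo : ∀ t ∈ T, ∃ p, ∃ a ∈ T, ∃ b ∈ T, IsPotential G φ (W.erase t) p ∧ a ≠ b ∧
        φ s(t, a) = p a ∧ φ s(t, b) = p b + 1 ∧ ∀ u ∈ W, G.Adj t u ↔ u = a ∨ u = b := by
      intro t ht
      obtain ⟨p, hp⟩ := hb t ht
      obtain ⟨a, ha, b, hb', h⟩ := hp.exists_two_neighbors hTW hT hsepH hb hn ht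
      exact ⟨p, a, ha, b, hb', hp, h⟩
    have hTW' : T = W := by
      refine subset_antisymm hTW ?_
      rw [← Finset.sdiff_eq_empty_iff_subset]
      by_contra hne
      rw [← Finset.not_nonempty_iff_eq_empty, not_not] at hne
      obtain ⟨a, -⟩ := id hne
      obtain ⟨y, hy, v, hv, hvY, -, -, hyv⟩ := hsepH (W \ T) Finset.sdiff_subset hne
        Finset.sdiff_disjoint a a
      have hvT : v ∈ T := by
        by_contra h
        exact hvY (Finset.mem_sdiff.2 ⟨hv, h⟩)
      obtain ⟨hyW, hyT⟩ := Finset.mem_sdiff.1 hy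
      obtain ⟨p, a, ha, b, hb, -, -, -, -, h⟩ := htwo v hvT
      rcases (h y hyW).1 hyv.symm with rfl | rfl
      exacts [hyT ha, hyT hb]
    rw [hTW'] at htwo hb
    have hWne : W.Nonempty := Finset.card_pos.1 (by omega)
    have hcyc : IsInducedCycle G W := by
      refine ⟨connOn_of_erase_potential hWne hb hn, fun u hu => ?_⟩
      obtain ⟨p, a, ha, b, hb, -, hab, -, -, h⟩ := htwo u hu
      rw [Finset.card_eq_two]
      refine ⟨a, b, hab, ?_⟩
      ext v
      simp only [Finset.mem_filter, Finset.mem_insert, Finset.mem_singleton]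
      constructor
      · exact fun hv => (h v hv.1).1 hv.2
      · intro hv
        have hvW : v ∈ W := by rcases hv with rfl | rfl <;> assumption
        exact ⟨hvW, (h v hvW).2 hv⟩
    have hSW : S \ W = K := by
      rw [hW, Finset.sdiff_sdiff_eq_self hKS]
    obtain ⟨t, ht⟩ := hWne
    have hper : IsPeripheral G S W := by
      refine ⟨hWS, hcyc, ?_⟩
      rw [hSW]
      refine hK.resolve_left fun hK => ?_
      have h2 := hcyc.2 t ht
      have h3 := hdeg t (hWS ht)
      rw [hK, Finset.sdiff_empty] at hW
      rw [hW] at h2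
      omega
    obtain ⟨p, a, ha, b, hb, hp, hab, hpa, hpb, h⟩ := htwo t ht
    have hadj := (h b hb).2 (Or.inr rfl)
    have hsum := hφ W hper (Finset.disjoint_left.2 hWK)
    have hpot : IsPotential G (fun e => φ e + if e = s(t, b) then 1 else 0) W
        (fun v => if v = t then 0 else p v) := by
      have at_t : ∀ v ∈ W, G.Adj t v →
          φ s(t, v) + (if s(t, v) = s(t, b) then 1 else 0) = p v := by
        intro v hv htv
        rcases (h v hv).1 htv with rfl | rfl
        · rw [if_neg fun h => hab (Sym2.congr_right.1 h), hpa, add_zero]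
        · rw [if_pos rfl, hpb]
          generalize p v = c
          decide +revert
      intro u hu v hv huv
      by_cases hut : u = t
      · subst hut
        simp only [if_true, if_neg huv.ne', zero_add]
        exact at_t v hv huv
      by_cases hvt : v = t
      · subst hvt
        simp only [if_true, if_neg huv.ne, add_zero, Sym2.eq_swap (a := u)]
        exact at_t u hu huv.symm
      · simp only [if_neg hut, if_neg hvt]
        rw [if_neg, add_zero, hp u (by simp [hu, hut]) v (by simp [hv, hvt]) huv]
        rw [Sym2.eq_iff]
        tauto
    have := hpot.sum_eq_zero hcyc
    rw [Finset.sum_add_distrib, hsum, Finset.sum_ite_eq', if_pos (mk_mem_edgesIn.2 ⟨ht, hb, hadj⟩)]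
      at this
    simp at this

end CycleSums

section LinearAlgebra

open scoped Classical

theorem finrank_range_lt_of_sum_eq_zero {M I : Type} [AddCommGroup M] [Module (ZMod 2) M]
    [Fintype I] [Nonempty I] (A : M →ₗ[ZMod 2] (I → ZMod 2)) (hA : ∀ m, ∑ i, A m i = 0) :
    Module.finrank (ZMod 2) (LinearMap.range A) + 1 ≤ Fintype.card I := by
  let σ : (I → ZMod 2) →ₗ[ZMod 2] ZMod 2 := ∑ i, LinearMap.proj i
  have hσ : ∀ f, σ f = ∑ i, f i := fun f => by simp [σ]
  have hsurj : Function.Surjective σ := fun c => by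
    obtain ⟨i⟩ := ‹Nonempty I›
    exact ⟨Pi.single i c, by simp [hσ]⟩
  have h1 := σ.finrank_range_add_finrank_ker
  rw [LinearMap.range_eq_top.2 hsurj, finrank_top, Module.finrank_self, Module.finrank_pi] at h1
  have h2 : LinearMap.range A ≤ LinearMap.ker σ := by
    rintro _ ⟨m, rfl⟩
    rw [LinearMap.mem_ker, hσ, hA]
  have := Submodule.finrank_mono h2
  omega

theorem finrank_range_lt_of_map_one {M J : Type} [AddCommGroup M] [Module (ZMod 2) M]
    [Fintype J] [Nonempty J] (B : (J → ZMod 2) →ₗ[ZMod 2] M) (hB : B 1 = 0) :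
    Module.finrank (ZMod 2) (LinearMap.range B) + 1 ≤ Fintype.card J := by
  have h1 := B.finrank_range_add_finrank_ker
  rw [Module.finrank_pi] at h1
  have h2 : 0 < Module.finrank (ZMod 2) (LinearMap.ker B) := by
    rw [Module.finrank_pos_iff_exists_ne_zero]
    exact ⟨⟨1, hB⟩, fun h => one_ne_zero (congrArg Subtype.val h)⟩
  omega

variable {V : Type} {G : SimpleGraph V}

theorem edgesIn_mono {U W : Finset V} (h : U ⊆ W) : edgesIn G U ⊆ edgesIn G W :=
  Finset.filter_subset_filter _ (Finset.sym2_mono h)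

theorem mem_of_mem_edgesIn {U : Finset V} {e : Sym2 V} (he : e ∈ edgesIn G U) {v : V} (hv : v ∈ e) :
    v ∈ U := by
  obtain ⟨w, rfl⟩ := Sym2.mem_iff_exists.1 hv
  exact (mk_mem_edgesIn.1 he).1

/-- Every edge lies on a peripheral cycle that avoids a prescribed further vertex. -/
theorem exists_peripheral_avoiding [Fintype V] {S : Finset V}
    (hdeg : ∀ v ∈ S, 3 ≤ (S.filter (G.Adj v)).card) (hsep : NoTwoSep G S) {x y w : V}
    (hx : x ∈ S) (hy : y ∈ S) (hw : w ∈ S) (hxy : G.Adj x y) (hwx : w ≠ x) (hwy : w ≠ y) :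
    ∃ U, IsPeripheral G S U ∧ x ∈ U ∧ y ∈ U ∧ w ∉ U := by
  by_contra hcon
  push Not at hcon
  obtain ⟨p, hp⟩ := exists_isPotential_of_peripheral hdeg hsep
    (φ := fun e => if e = s(x, y) then 1 else 0) _ {w} (by simpa using hw)
    (Or.inr (connOn_singleton w)) rfl (fun U hU hd => by
      rw [Finset.sum_ite_eq', if_neg]
      intro h
      obtain ⟨h1, h2, -⟩ := mk_mem_edgesIn.1 h
      exact Finset.disjoint_left.1 hd (hcon U hU h1 h2) (by simp))
  have hpxy := hp x (by simp [hx, hwx.symm]) y (by simp [hy, hwy.symm]) hxy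
  beta_reduce at hpxy
  rw [if_pos rfl] at hpxy
  have key := hsep (S.filter fun u => u ≠ w ∧ u ≠ x ∧ p u = p y) (Finset.filter_subset _ _)
    ⟨y, by simp [hy, hwy.symm, hxy.ne']⟩ w x (fun u hu v hv huv => by
      by_contra h
      push Not at h
      obtain ⟨hu, huw, hux, hup⟩ := Finset.mem_filter.1 hu
      have := hp u (by simp [hu, huw]) v (by simp [hv, h.2.1]) huv
      beta_reduce at this
      rw [if_neg (by simp [hux, h.2.2]), hup] at this
      refine h.1 (Finset.mem_filter.2 ⟨hv, h.2.1, h.2.2, ?_⟩)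
      revert this
      generalize p v = a
      generalize p y = b
      decide +revert)
  obtain ⟨z, hz, hzn⟩ : ∃ z ∈ S.filter (G.Adj x), z ∉ ({w, y} : Finset V) := by
    by_contra h
    push Not at h
    have h1 := Finset.card_le_card h
    have := Finset.card_le_two (a := w) (b := y)
    have := hdeg x hx
    omega
  rw [Finset.mem_filter] at hz
  simp only [Finset.mem_insert, Finset.mem_singleton, not_or] at hzn
  have hzp : p z = p y := by
    rcases key z hz.1 with h | h | h
    · exact (Finset.mem_filter.1 h).2.2.2
    · exact absurd h hzn.1
    · exact absurd h hz.2.ne'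
  have := hp x (by simp [hx, hwx.symm]) z (by simp [hz.1, hzn.1]) hz.2
  beta_reduce at this
  rw [if_neg (by simp [hzn.2, hxy.ne]), hzp, ← hpxy] at this
  simp at this

/-- The peripheral cycles of `G` within `S`. -/
noncomputable def peripherals [Fintype V] (G : SimpleGraph V) (S : Finset V) : Finset (Finset V) :=
  Finset.univ.filter (IsPeripheral G S)

theorem mem_peripherals [Fintype V] {S U : Finset V} : U ∈ peripherals G S ↔ IsPeripheral G S U := by
  simp [peripherals]

theorem IsPlanar.card_peripherals_edge [Fintype V] (hpl : IsPlanar G) {S : Finset V}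
    (hdeg : ∀ v ∈ S, 3 ≤ (S.filter (G.Adj v)).card) (hsep : NoTwoSep G S) {e : Sym2 V}
    (he : e ∈ edgesIn G S) : ((peripherals G S).filter (e ∈ edgesIn G ·)).card = 2 := by
  induction e with | _ x y
  obtain ⟨hx, hy, hxy⟩ := mk_mem_edgesIn.1 he
  have third : ∃ w ∈ S, w ≠ x ∧ w ≠ y := by
    by_contra h
    push Not at h
    have : S.filter (G.Adj x) ⊆ {y} := fun z hz => by
      rw [Finset.mem_filter] at hz
      simpa using h z hz.1 hz.2.ne'
    have := Finset.card_le_card this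
    have := hdeg x hx
    simp at *
    omega
  obtain ⟨w, hw, hwx, hwy⟩ := third
  obtain ⟨U, hU, hxU, hyU, -⟩ := exists_peripheral_avoiding hdeg hsep hx hy hw hxy hwx hwy
  have third : ∃ w ∈ U, w ≠ x ∧ w ≠ y := by
    obtain ⟨-, ⟨w, hw, -⟩, -⟩ := hU.2.1.connOn_sdiff_pair hxU hyU hxy
    rw [Finset.mem_sdiff] at hw
    exact ⟨w, hw.1, by simpa using hw.2⟩
  obtain ⟨w', hw', hwx', hwy'⟩ := third
  obtain ⟨W, hW, hxW, hyW, hwW⟩ :=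
    exists_peripheral_avoiding hdeg hsep hx hy (hU.1 hw') hxy hwx' hwy'
  have hne : U ≠ W := fun h => hwW (h ▸ hw')
  rw [Finset.card_eq_two]
  refine ⟨U, W, hne, ?_⟩
  ext Z
  simp only [Finset.mem_filter, mem_peripherals, mk_mem_edgesIn, Finset.mem_insert,
    Finset.mem_singleton]
  constructor
  · rintro ⟨hZ, hxZ, hyZ, -⟩
    by_contra h
    rw [not_or] at h
    exact hU.no_three hpl hdeg hW hZ hne (Ne.symm h.1) (Ne.symm h.2) hxy hxU hxW hxZ hyU hyW hyZ
  · rintro (rfl | rfl)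
    exacts [⟨hU, hxU, hyU, hxy⟩, ⟨hW, hxW, hyW, hxy⟩]

/-- A lower bound for the number of peripheral cycles. -/
theorem IsPlanar.card_edgesIn_le [Fintype V] (hpl : IsPlanar G) {S : Finset V} (hS : S.Nonempty)
    (hdeg : ∀ v ∈ S, 3 ≤ (S.filter (G.Adj v)).card) (hsep : NoTwoSep G S) :
    (edgesIn G S).card + 2 ≤ (peripherals G S).card + S.card := by
  let E := edgesIn G S
  let A : (E → ZMod 2) →ₗ[ZMod 2] (peripherals G S → ZMod 2) :=
    { toFun := fun m U => ∑ e : E, if e.1 ∈ edgesIn G U.1 then m e else 0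
      map_add' := fun m m' => by
        ext U
        simp only [Pi.add_apply, ← Finset.sum_add_distrib]
        exact Finset.sum_congr rfl fun e _ => by split_ifs <;> simp
      map_smul' := fun c m => by
        ext U
        simp [Finset.mul_sum] }
  let B : (S → ZMod 2) →ₗ[ZMod 2] (E → ZMod 2) :=
    { toFun := fun p e => ∑ v : S, if v.1 ∈ e.1 then p v else 0
      map_add' := fun m m' => by
        ext U
        simp only [Pi.add_apply, ← Finset.sum_add_distrib]
        exact Finset.sum_congr rfl fun e _ => by split_ifs <;> simp
      map_smul' := fun c m => by
        ext U
        simp [Finset.mul_sum] }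
  have hB : ∀ p : S → ZMod 2, ∀ e : E, B p e =
      coboundary (fun v => if h : v ∈ S then p ⟨v, h⟩ else 0) e.1 := by
    intro p e
    change (∑ v : S, if v.1 ∈ e.1 then p v else 0) = _
    rw [coboundary, ← Finset.sum_filter]
    refine Finset.sum_bij (fun v _ => v.1) ?_ ?_ ?_ ?_
    · simp
    · exact fun a _ b _ h => Subtype.ext h
    · intro v hv
      rw [Sym2.mem_toFinset] at hv
      exact ⟨⟨v, mem_of_mem_edgesIn e.2 hv⟩, by simpa using hv, rfl⟩
    · intro v _
      simp
  obtain ⟨x, hx⟩ := hS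
  obtain ⟨y, hy⟩ : (S.filter (G.Adj x)).Nonempty := Finset.card_pos.1 (by have := hdeg x hx; omega)
  rw [Finset.mem_filter] at hy
  have hN : Nonempty (peripherals G S) := by
    have := hpl.card_peripherals_edge hdeg hsep (mk_mem_edgesIn.2 ⟨hx, hy.1, hy.2⟩)
    obtain ⟨U, hU⟩ := Finset.card_pos.1 (this.symm ▸ Nat.zero_lt_two)
    exact ⟨⟨U, (Finset.mem_filter.1 hU).1⟩⟩
  have hSne : Nonempty S := ⟨⟨x, hx⟩⟩
  have hA1 := finrank_range_lt_of_sum_eq_zero A (fun m => by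
    change (∑ U : peripherals G S, ∑ e : E, if e.1 ∈ edgesIn G U.1 then m e else 0) = 0
    rw [Finset.sum_comm]
    refine Finset.sum_eq_zero fun e _ => ?_
    rw [Finset.sum_coe_sort (peripherals G S) (fun U => if e.1 ∈ edgesIn G U then m e else 0),
      ← Finset.sum_filter, Finset.sum_const, hpl.card_peripherals_edge hdeg hsep e.2,
      two_nsmul, CharTwo.add_self_eq_zero])
  have hB1 := finrank_range_lt_of_map_one B (by
    ext e
    obtain ⟨⟨u, v⟩, he⟩ := e
    obtain ⟨hu, hv, huv⟩ := mk_mem_edgesIn.1 he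
    rw [hB]
    change coboundary _ s(u, v) = 0
    rw [coboundary_mk _ huv.ne]
    simp only [dif_pos hu, dif_pos hv, Pi.one_apply]
    decide)
  have hker : LinearMap.ker A ≤ LinearMap.range B := by
    intro m hm
    rw [LinearMap.mem_ker] at hm
    obtain ⟨p, hp⟩ := exists_isPotential_of_peripheral hdeg hsep
      (φ := fun e => if h : e ∈ E then m ⟨e, h⟩ else 0) _ ∅ (by simp) (Or.inl rfl) rfl
      (fun U hU _ => by
        have := congrFun hm ⟨U, mem_peripherals.2 hU⟩
        change (∑ e : E, if e.1 ∈ edgesIn G U then m e else 0) = 0 at this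
        rw [← this, ← Finset.sum_filter]
        symm
        refine Finset.sum_bij (fun e _ => e.1) ?_ ?_ ?_ ?_
        · simp
        · exact fun a _ b _ h => Subtype.ext h
        · intro e he
          exact ⟨⟨e, edgesIn_mono hU.1 he⟩, by simpa using he, rfl⟩
        · intro e _
          simp)
    rw [Finset.sdiff_empty] at hp
    refine ⟨fun v => p v, ?_⟩
    ext e
    rw [hB]
    have h1 := hp.eq_coboundary e.2
    rw [dif_pos e.2] at h1
    rw [h1]
    refine Finset.sum_congr rfl fun v hv => ?_
    rw [Sym2.mem_toFinset] at hv
    simp [mem_of_mem_edgesIn e.2 hv]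
  have hr := A.finrank_range_add_finrank_ker
  have hle := Submodule.finrank_mono hker
  rw [Module.finrank_pi] at hr
  simp only [Fintype.card_coe] at hr hA1 hB1
  change E.card + 2 ≤ _
  omega

theorem card_edgesIn_lt_of_no_even [Fintype V] {S : Finset V} (hS : S.Nonempty)
    {E : Finset (Sym2 V)} (hE : E ⊆ edgesIn G S)
    (h : ∀ F ⊆ E, F.Nonempty → ¬ IsEvenSet F) : E.card + 1 ≤ S.card := by
  let D : (E → ZMod 2) →ₗ[ZMod 2] (S → ZMod 2) :=
    { toFun := fun m v => ∑ e : E, if v.1 ∈ e.1 then m e else 0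
      map_add' := fun m m' => by
        ext U
        simp only [Pi.add_apply, ← Finset.sum_add_distrib]
        exact Finset.sum_congr rfl fun e _ => by split_ifs <;> simp
      map_smul' := fun c m => by
        ext U
        simp [Finset.mul_sum] }
  have hSne : Nonempty S := hS.to_subtype
  have hD := finrank_range_lt_of_sum_eq_zero D (fun m => by
    change (∑ v : S, ∑ e : E, if v.1 ∈ e.1 then m e else 0) = 0
    rw [Finset.sum_comm]
    refine Finset.sum_eq_zero fun e _ => ?_
    rw [Finset.sum_coe_sort S (fun v => if v ∈ e.1 then m e else 0),
      ← Finset.sum_filter, Finset.sum_const]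
    obtain ⟨⟨u, v⟩, he⟩ := e
    obtain ⟨hu, hv, huv⟩ := mk_mem_edgesIn.1 (hE he)
    have : S.filter (· ∈ s(u, v)) = {u, v} := by
      ext z
      simp only [Finset.mem_filter, Sym2.mem_iff, Finset.mem_insert, Finset.mem_singleton]
      constructor
      · exact fun h => h.2
      · rintro (rfl | rfl) <;> simp [*]
    change (S.filter (· ∈ s(u, v))).card • _ = _
    rw [this, Finset.card_pair huv.ne, two_nsmul, CharTwo.add_self_eq_zero])
  have hinj : LinearMap.ker D = ⊥ := by
    rw [LinearMap.ker_eq_bot']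
    intro m hm
    by_contra hne
    obtain ⟨e₀, he₀⟩ := Function.ne_iff.1 hne
    refine h (E.filter fun e => ∃ h : e ∈ E, m ⟨e, h⟩ ≠ 0) (Finset.filter_subset _ _)
      ⟨e₀, by simpa using he₀⟩ fun v => ?_
    by_cases hv : v ∈ S
    · have h1 := congrFun hm ⟨v, hv⟩
      change (∑ e : E, if v ∈ e.1 then m e else 0) = 0 at h1
      have h2 : ((((E.filter fun e => ∃ h : e ∈ E, m ⟨e, h⟩ ≠ 0).filter (v ∈ ·)).card : ℕ) : ZMod 2)
          = 0 := by
        refine Eq.trans ?_ h1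
        rw [← Finset.sum_filter, Finset.card_eq_sum_ones, Nat.cast_sum, Finset.filter_filter]
        refine Finset.sum_bij_ne_zero (fun e he _ => ⟨e, (Finset.mem_filter.1 he).1⟩) ?_ ?_ ?_ ?_
        · intro e he _
          simpa using (Finset.mem_filter.1 he).2.2
        · intro a _ _ b _ _ hab
          exact congrArg Subtype.val hab
        · intro e he hme
          have : v ∈ e.1 := by simpa using he
          exact ⟨e.1, by simp [this, hme], by simp, rfl⟩
        · intro e he _
          obtain ⟨-, ⟨he, hme⟩, -⟩ := Finset.mem_filter.1 he
          have := (zmod_two_eq_or (m ⟨e, he⟩) 0).resolve_left hme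
          simp [this]
      exact (ZMod.natCast_eq_zero_iff_even).1 h2
    · rw [Finset.filter_false_of_mem]
      · simp
      · exact fun e he hve => hv (mem_of_mem_edgesIn (hE (Finset.filter_subset _ _ he)) hve)
  have hr := D.finrank_range_add_finrank_ker
  rw [hinj, finrank_bot, Module.finrank_pi] at hr
  simp only [Fintype.card_coe] at hr hD
  omega

/-- Euler's bound for planar graphs without small separations. -/
theorem IsPlanar.card_edgesIn_le_weight [Fintype V] (hpl : IsPlanar G) {S : Finset V}
    (hS : S.Nonempty) (hdeg : ∀ v ∈ S, 3 ≤ (S.filter (G.Adj v)).card) (hsep : NoTwoSep G S)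
    {w : Sym2 V → ℝ}
    (hF : ∀ F ⊆ edgesIn G S, F.Nonempty → IsEvenSet F → 1 ≤ ∑ e ∈ F, w e) :
    ((edgesIn G S).card : ℝ) - S.card + 2 ≤ 2 * ∑ e ∈ edgesIn G S, w e := by
  have h1 : ((edgesIn G S).card : ℝ) + 2 ≤ (peripherals G S).card + S.card := by
    exact_mod_cast hpl.card_edgesIn_le hS hdeg hsep
  have h2 : ((peripherals G S).card : ℝ) ≤ ∑ U ∈ peripherals G S, ∑ e ∈ edgesIn G U, w e := by
    rw [Finset.card_eq_sum_ones, Nat.cast_sum, Nat.cast_one]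
    refine Finset.sum_le_sum fun U hU => ?_
    rw [mem_peripherals] at hU
    refine hF _ (edgesIn_mono hU.1) ?_ hU.2.1.isEvenSet
    obtain ⟨u, hu⟩ := hU.2.1.1.1
    obtain ⟨a, ha, -, -, -, hua, -⟩ := hU.2.1.exists_two hu
    exact ⟨s(u, a), mk_mem_edgesIn.2 ⟨hu, ha, hua⟩⟩
  have h3 : ∑ U ∈ peripherals G S, ∑ e ∈ edgesIn G U, w e = 2 * ∑ e ∈ edgesIn G S, w e := by
    rw [Finset.mul_sum, Finset.sum_comm' (t' := edgesIn G S)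
      (s' := fun e => (peripherals G S).filter (e ∈ edgesIn G ·))]
    · refine Finset.sum_congr rfl fun e he => ?_
      rw [Finset.sum_const, hpl.card_peripherals_edge hdeg hsep he, nsmul_eq_mul, Nat.cast_two]
    · intro U e
      simp only [Finset.mem_filter, mem_peripherals]
      constructor
      · exact fun h => ⟨h, edgesIn_mono h.1.1 h.2⟩
      · exact fun h => h.1
  linarith

end LinearAlgebra

section EvenSets

open scoped Classical

variable {V : Type} {G : SimpleGraph V}

theorem IsEvenSet.symmDiff {F D : Finset (Sym2 V)} (hF : IsEvenSet F) (hD : IsEvenSet D) :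
    IsEvenSet (symmDiff F D) := by
  intro v
  have e : (_root_.symmDiff F D).filter (v ∈ ·) =
      (F.filter (v ∈ ·) \ D.filter (v ∈ ·)) ∪ (D.filter (v ∈ ·) \ F.filter (v ∈ ·)) := by
    ext e
    simp only [Finset.mem_filter, Finset.mem_symmDiff, Finset.mem_union, Finset.mem_sdiff]
    tauto
  rw [e, Finset.card_union_of_disjoint
    (Finset.disjoint_of_subset_right Finset.sdiff_subset Finset.sdiff_disjoint)]
  have h1 := Finset.card_sdiff_add_card_inter (F.filter (v ∈ ·)) (D.filter (v ∈ ·))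
  have h2 := Finset.card_sdiff_add_card_inter (D.filter (v ∈ ·)) (F.filter (v ∈ ·))
  rw [Finset.inter_comm] at h2
  have h3 := hF v
  have h4 := hD v
  rw [Nat.even_iff] at *
  omega

theorem isEvenSet_triangle {v a b : V} (hva : v ≠ a) (hvb : v ≠ b) (hab : a ≠ b) :
    IsEvenSet {s(v, a), s(v, b), s(a, b)} := by
  intro z
  have n1 : s(v, a) ≠ s(v, b) := fun h => hab (Sym2.congr_right.1 h)
  have n2 : s(v, a) ≠ s(a, b) := by simp [hva, hvb]
  have n3 : s(v, b) ≠ s(a, b) := by simp [hva, hvb]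
  by_cases h1 : z = v
  · subst h1
    simp [Finset.filter_insert, Finset.filter_singleton, hva, hvb, n1]
  by_cases h2 : z = a
  · subst h2
    simp [Finset.filter_insert, Finset.filter_singleton, n2, hab, h1]
  by_cases h3 : z = b
  · subst h3
    simp [Finset.filter_insert, Finset.filter_singleton, n3, h1, h2]
  simp [Finset.filter_insert, Finset.filter_singleton, h1, h2, h3]

/-- Replace the edge `ab` by the path `avb`. -/
theorem IsEvenSet.reroute {F : Finset (Sym2 V)} (hF : IsEvenSet F) {v a b : V} (hva : v ≠ a)
    (hvb : v ≠ b) (hab : a ≠ b) (h : s(a, b) ∈ F) (h₁ : s(v, a) ∉ F) (h₂ : s(v, b) ∉ F) :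
    IsEvenSet (insert s(v, a) (insert s(v, b) (F.erase s(a, b)))) := by
  have n2 : s(v, a) ≠ s(a, b) := by simp [hva, hvb]
  have n3 : s(v, b) ≠ s(a, b) := by simp [hva, hvb]
  convert hF.symmDiff (isEvenSet_triangle hva hvb hab) using 1
  ext e
  simp only [Finset.mem_symmDiff, Finset.mem_insert, Finset.mem_erase, Finset.mem_singleton]
  by_cases e1 : e = s(v, a)
  · subst e1; tauto
  by_cases e2 : e = s(v, b)
  · subst e2; tauto
  by_cases e3 : e = s(a, b)
  · subst e3; tauto
  tauto

/-- Replace the path `avb` by the edge `ab`. -/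
theorem IsEvenSet.shortcut {F : Finset (Sym2 V)} (hF : IsEvenSet F) {v a b : V} (hva : v ≠ a)
    (hvb : v ≠ b) (hab : a ≠ b) (h : s(a, b) ∉ F) (h₁ : s(v, a) ∈ F) (h₂ : s(v, b) ∈ F) :
    IsEvenSet (insert s(a, b) ((F.erase s(v, a)).erase s(v, b))) := by
  have n2 : s(v, a) ≠ s(a, b) := by simp [hva, hvb]
  have n3 : s(v, b) ≠ s(a, b) := by simp [hva, hvb]
  convert hF.symmDiff (isEvenSet_triangle hva hvb hab) using 1
  ext e
  simp only [Finset.mem_symmDiff, Finset.mem_insert, Finset.mem_erase, Finset.mem_singleton]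
  by_cases e1 : e = s(v, a)
  · subst e1; tauto
  by_cases e2 : e = s(v, b)
  · subst e2; tauto
  by_cases e3 : e = s(a, b)
  · subst e3; tauto
  tauto

theorem sum_reroute {w : Sym2 V → ℝ} {F : Finset (Sym2 V)} {v a b : V} (hab : a ≠ b)
    (h : s(a, b) ∈ F) (h₁ : s(v, a) ∉ F) (h₂ : s(v, b) ∉ F) :
    ∑ e ∈ insert s(v, a) (insert s(v, b) (F.erase s(a, b))), w e =
      ∑ e ∈ F, w e - w s(a, b) + (w s(v, a) + w s(v, b)) := by
  have n1 : s(v, a) ≠ s(v, b) := fun h => hab (Sym2.congr_right.1 h)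
  rw [Finset.sum_insert (by simp [n1, h₁, hab]), Finset.sum_insert (by simp [h₂]),
    ← Finset.add_sum_erase F w h]
  ring

/-- The graph obtained by replacing the path `avb` by the edge `ab`. -/
def contractPath (G : SimpleGraph V) (v : V) {a b : V} (hab : a ≠ b) : SimpleGraph V where
  Adj x y := (G.Adj x y ∧ x ≠ v ∧ y ≠ v) ∨ (x = a ∧ y = b) ∨ (x = b ∧ y = a)
  symm := ⟨fun x y h => by
    rcases h with h | h | h
    · exact Or.inl ⟨h.1.symm, h.2.2, h.2.1⟩
    · exact Or.inr (Or.inr h.symm)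
    · exact Or.inr (Or.inl h.symm)⟩
  loopless := ⟨fun x h => by
    rcases h with h | h | h
    · exact h.1.ne rfl
    · exact hab (h.1.symm.trans h.2)
    · exact hab (h.2.symm.trans h.1)⟩

theorem IsMinor.of_contractPath [Fintype V] {W : Type} {H : SimpleGraph W}
    (hH : ∀ x, ∃ y, H.Adj x y) {v a b : V} (hab : a ≠ b) (hva : G.Adj v a) (hvb : G.Adj v b)
    (h : IsMinor H (contractPath G v hab)) : IsMinor H G := by
  obtain ⟨B, hc, hd, ht⟩ := h.exists_connOn
  have hiso : ∀ y, ¬ (contractPath G v hab).Adj v y := by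
    rintro y (h | h | h)
    exacts [h.2.1 rfl, hva.ne h.1, hvb.ne h.1]
  have hvB : ∀ w, v ∉ B w := by
    intro w hw
    have hs : {v} = B w := by
      by_contra hne
      obtain ⟨x, hx, y, -, -, hxy⟩ := (hc w).2 {v} (by simpa using hw) (by simp) hne
      rw [Finset.mem_singleton] at hx
      exact hiso y (hx ▸ hxy)
    obtain ⟨w', hw'⟩ := hH w
    obtain ⟨x, hx, y, -, hxy⟩ := ht w w' hw'
    rw [← hs, Finset.mem_singleton] at hx
    exact hiso y (hx ▸ hxy)
  refine isMinor_of_connOn (fun w => if a ∈ B w then insert v (B w) else B w) ?_ ?_ ?_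
  · intro w
    by_cases haB : a ∈ B w
    · simp only [if_pos haB]
      refine ⟨by simp, fun A hA hne hAB => ?_⟩
      by_cases h1 : (A ∩ B w).Nonempty
      · by_cases h2 : A ∩ B w = B w
        · refine ⟨a, ?_, v, by simp, ?_, hva.symm⟩
          · rw [← h2] at haB
            exact (Finset.mem_inter.1 haB).1
          · intro hvA
            refine hAB (subset_antisymm hA (Finset.insert_subset hvA ?_))
            rw [← h2]
            exact Finset.inter_subset_left
        · obtain ⟨x, hx, y, hy, hyA, hxy⟩ := (hc w).2 _ Finset.inter_subset_right h1 h2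
          have hx' := (Finset.mem_inter.1 hx).1
          have hyA' : y ∉ A := fun h => hyA (Finset.mem_inter.2 ⟨h, hy⟩)
          have hy' : y ∈ insert v (B w) := by simp [hy]
          rcases hxy with h | h
          · exact ⟨x, hx', y, hy', hyA', h.1⟩
          have hvx : G.Adj v x := by rcases h with h | h <;> rw [h.1] <;> assumption
          have hvy : G.Adj v y := by rcases h with h | h <;> rw [h.2] <;> assumption
          by_cases hvA : v ∈ A
          · exact ⟨v, hvA, y, hy', hyA', hvy⟩
          · exact ⟨x, hx', v, by simp, hvA, hvx.symm⟩
      · have hAv : ∀ x ∈ A, x = v := fun x hx => by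
          rcases Finset.mem_insert.1 (hA hx) with h | h
          · exact h
          · exact absurd ⟨x, Finset.mem_inter.2 ⟨hx, h⟩⟩ h1
        obtain ⟨x, hx⟩ := hne
        refine ⟨x, hx, a, by simp [haB], fun h => hva.ne (hAv a h).symm, ?_⟩
        rw [hAv x hx]
        exact hva
    · simp only [if_neg haB]
      refine ⟨(hc w).1, fun A hA hne hAB => ?_⟩
      obtain ⟨x, hx, y, hy, hyA, hxy⟩ := (hc w).2 A hA hne hAB
      rcases hxy with h | h | h
      · exact ⟨x, hx, y, hy, hyA, h.1⟩
      · exact absurd (h.1 ▸ hA hx) haB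
      · exact absurd (h.2 ▸ hy) haB
  · intro w w' hne
    have h1 : Disjoint (B w) (B w') := hd w w' hne
    split_ifs with h2 h3 h3
    · exact absurd h3 (Finset.disjoint_left.1 h1 h2)
    · simp [hvB, h1]
    · simp [hvB, h1]
    · exact h1
  · intro w w' hww
    have hmono : ∀ w, B w ⊆ if a ∈ B w then insert v (B w) else B w := by
      intro w
      split_ifs
      · exact Finset.subset_insert _ _
      · exact subset_rfl
    obtain ⟨x, hx, y, hy, hxy⟩ := ht w w' hww
    rcases hxy with h | ⟨rfl, rfl⟩ | ⟨rfl, rfl⟩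
    · exact ⟨x, hmono _ hx, y, hmono _ hy, h.1⟩
    · exact ⟨v, by simp [hx], y, hmono _ hy, hvb⟩
    · exact ⟨x, hmono _ hx, v, by simp [hy], hvb.symm⟩

theorem IsPlanar.contractPath [Fintype V] (h : IsPlanar G) {v a b : V} (hab : a ≠ b)
    (hva : G.Adj v a) (hvb : G.Adj v b) : IsPlanar (contractPath G v hab) := by
  refine ⟨fun hm => h.1 (hm.of_contractPath (fun x => ⟨x + 1, ?_⟩) hab hva hvb),
    fun hm => h.2 (hm.of_contractPath (fun x => ?_) hab hva hvb)⟩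
  · change x ≠ x + 1
    decide +revert
  · rcases x with i | i
    · exact ⟨Sum.inr i, by simp⟩
    · exact ⟨Sum.inl i, by simp⟩

end EvenSets

section Euler

open scoped Classical

variable {V : Type} {G : SimpleGraph V}

/-- Every nonempty even set of edges inside `S` has weight at least one. -/
def HeavyOn (G : SimpleGraph V) (S : Finset V) (w : Sym2 V → ℝ) : Prop :=
  ∀ F ⊆ edgesIn G S, F.Nonempty → IsEvenSet F → 1 ≤ ∑ e ∈ F, w e

/-- The weighted Euler bound for planar graphs on `S`. -/
def EulerBound (S : Finset V) : Prop :=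
  ∀ (G : SimpleGraph V) (w : Sym2 V → ℝ), IsPlanar G → (∀ e, 0 ≤ w e) → HeavyOn G S w →
    (∃ F ⊆ edgesIn G S, F.Nonempty ∧ IsEvenSet F) →
    ((edgesIn G S).card : ℝ) - S.card + 2 ≤ 2 * ∑ e ∈ edgesIn G S, w e

theorem HeavyOn.one_le {S : Finset V} {w : Sym2 V → ℝ} (hw : ∀ e, 0 ≤ w e) (h : HeavyOn G S w)
    (hex : ∃ F ⊆ edgesIn G S, F.Nonempty ∧ IsEvenSet F) : 1 ≤ ∑ e ∈ edgesIn G S, w e := by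
  obtain ⟨F, hF, hne, he⟩ := hex
  exact (h F hF hne he).trans (Finset.sum_le_sum_of_subset_of_nonneg hF fun e _ _ => hw e)

theorem edgesIn_erase {S : Finset V} {v : V} :
    edgesIn G (S.erase v) = (edgesIn G S).filter (v ∉ ·) := by
  ext e
  induction e with | _ x y
  simp only [mk_mem_edgesIn, Finset.mem_erase, Finset.mem_filter, Sym2.mem_iff]
  constructor
  · rintro ⟨⟨h1, h2⟩, ⟨h3, h4⟩, h5⟩
    exact ⟨⟨h2, h4, h5⟩, fun h => h.elim (fun h => h1 h.symm) fun h => h3 h.symm⟩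
  · rintro ⟨⟨h2, h4, h5⟩, h⟩
    exact ⟨⟨fun h' => h (Or.inl h'.symm), h2⟩, ⟨fun h' => h (Or.inr h'.symm), h4⟩, h5⟩

theorem card_edgesIn_erase {S : Finset V} {v : V} (hv : v ∈ S) :
    (edgesIn G S).card = (S.filter (G.Adj v)).card + (edgesIn G (S.erase v)).card := by
  rw [edgesIn_erase, ← card_edgesIn_filter_mem hv, Finset.card_filter_add_card_filter_not]

theorem euler_of_degree_le_one {S : Finset V} (ih : ∀ T ⊂ S, EulerBound T) {w : Sym2 V → ℝ}
    (hpl : IsPlanar G) (hw : ∀ e, 0 ≤ w e) (hF : HeavyOn G S w)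
    (hex : ∃ F ⊆ edgesIn G S, F.Nonempty ∧ IsEvenSet F) {v : V} (hv : v ∈ S)
    (hd : (S.filter (G.Adj v)).card ≤ 1) :
    ((edgesIn G S).card : ℝ) - S.card + 2 ≤ 2 * ∑ e ∈ edgesIn G S, w e := by
  have hsub := edgesIn_mono (G := G) (S.erase_subset v)
  have key := ih _ (Finset.erase_ssubset hv) G w hpl hw (fun F hF' => hF F (hF'.trans hsub)) (by
    obtain ⟨F, hF', hne, he⟩ := hex
    refine ⟨F, fun e heF => ?_, hne, he⟩
    rw [edgesIn_erase, Finset.mem_filter]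
    refine ⟨hF' heF, fun hve => ?_⟩
    have h1 := Finset.card_le_card (Finset.filter_subset_filter (v ∈ ·) hF')
    rw [card_edgesIn_filter_mem hv] at h1
    have h2 : 0 < (F.filter (v ∈ ·)).card := Finset.card_pos.2 ⟨e, by simp [heF, hve]⟩
    obtain ⟨k, hk⟩ := he v
    omega)
  have h1 : ((edgesIn G S).card : ℝ) ≤ 1 + (edgesIn G (S.erase v)).card := by
    rw [card_edgesIn_erase hv]
    push_cast
    have : ((S.filter (G.Adj v)).card : ℝ) ≤ 1 := by exact_mod_cast hd
    linarith
  have h2 : (S.card : ℝ) = (S.erase v).card + 1 := by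
    exact_mod_cast (Finset.card_erase_add_one hv).symm
  have h3 := Finset.sum_le_sum_of_subset_of_nonneg hsub fun e _ _ => hw e
  linarith

theorem edgesIn_of_degree_two {S : Finset V} {v a b : V} (hv : v ∈ S) (hab : a ≠ b)
    (hN : S.filter (G.Adj v) = {a, b}) :
    edgesIn G S = insert s(v, a) (insert s(v, b) (edgesIn G (S.erase v))) := by
  have ha : a ∈ S.filter (G.Adj v) := by simp [hN]
  have hb : b ∈ S.filter (G.Adj v) := by simp [hN]
  rw [Finset.mem_filter] at ha hb
  ext e
  rw [edgesIn_erase, Finset.mem_insert, Finset.mem_insert, Finset.mem_filter]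
  constructor
  · intro he
    by_cases hve : v ∈ e
    · obtain ⟨x, rfl⟩ := Sym2.mem_iff_exists.1 hve
      obtain ⟨-, hx, hvx⟩ := mk_mem_edgesIn.1 he
      have : x ∈ ({a, b} : Finset V) := hN ▸ Finset.mem_filter.2 ⟨hx, hvx⟩
      simp only [Finset.mem_insert, Finset.mem_singleton] at this
      rcases this with rfl | rfl
      exacts [Or.inl rfl, Or.inr (Or.inl rfl)]
    · exact Or.inr (Or.inr ⟨he, hve⟩)
  · rintro (rfl | rfl | h)
    exacts [mk_mem_edgesIn.2 ⟨hv, ha.1, ha.2⟩, mk_mem_edgesIn.2 ⟨hv, hb.1, hb.2⟩, h.1]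

theorem euler_of_degree_two [Fintype V] {S : Finset V} (ih : ∀ T ⊂ S, EulerBound T)
    {w : Sym2 V → ℝ} (hpl : IsPlanar G) (hw : ∀ e, 0 ≤ w e) (hF : HeavyOn G S w)
    (hex : ∃ F ⊆ edgesIn G S, F.Nonempty ∧ IsEvenSet F) {v : V} (hv : v ∈ S)
    (hd : (S.filter (G.Adj v)).card = 2) :
    ((edgesIn G S).card : ℝ) - S.card + 2 ≤ 2 * ∑ e ∈ edgesIn G S, w e := by
  have hone := hF.one_le hw hex
  obtain ⟨a, b, hab, hN⟩ := Finset.card_eq_two.1 hd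
  have ha : a ∈ S.filter (G.Adj v) := by simp [hN]
  have hb : b ∈ S.filter (G.Adj v) := by simp [hN]
  rw [Finset.mem_filter] at ha hb
  obtain ⟨haS, hva⟩ := ha
  obtain ⟨hbS, hvb⟩ := hb
  have haS' : a ∈ S.erase v := Finset.mem_erase.2 ⟨hva.ne', haS⟩
  have hbS' : b ∈ S.erase v := Finset.mem_erase.2 ⟨hvb.ne', hbS⟩
  have hE := edgesIn_of_degree_two hv hab hN
  have n1 : s(v, a) ≠ s(v, b) := fun h => hab (Sym2.congr_right.1 h)
  have n2 : s(v, a) ≠ s(a, b) := by simp [hva.ne, hvb.ne]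
  have n3 : s(v, b) ≠ s(a, b) := by simp [hva.ne, hvb.ne]
  have hvE : ∀ x, s(v, x) ∉ edgesIn G (S.erase v) := fun x h => by
    simpa using (mk_mem_edgesIn.1 h).1
  have hsum : ∑ e ∈ edgesIn G S, w e =
      w s(v, a) + (w s(v, b) + ∑ e ∈ edgesIn G (S.erase v), w e) := by
    rw [hE, Finset.sum_insert (by simp [n1, hvE]), Finset.sum_insert (hvE b)]
  have hcard : ((edgesIn G S).card : ℝ) = (edgesIn G (S.erase v)).card + 2 := by
    rw [card_edgesIn_erase hv, hd]
    push_cast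
    ring
  have hScard : (S.card : ℝ) = (S.erase v).card + 1 := by
    exact_mod_cast (Finset.card_erase_add_one hv).symm
  have hsub := edgesIn_mono (G := G) (S.erase_subset v)
  have hvaE : s(v, a) ∈ edgesIn G S := mk_mem_edgesIn.2 ⟨hv, haS, hva⟩
  have hvbE : s(v, b) ∈ edgesIn G S := mk_mem_edgesIn.2 ⟨hv, hbS, hvb⟩
  have reroute : ∀ F : Finset (Sym2 V), (∀ e ∈ F, e ≠ s(a, b) → e ∈ edgesIn G (S.erase v)) →
      IsEvenSet F → s(a, b) ∈ F →
      1 ≤ ∑ e ∈ F, w e - w s(a, b) + (w s(v, a) + w s(v, b)) := by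
    intro F hFs he habF
    have h1 : s(v, a) ∉ F := fun h => hvE a (hFs _ h n2)
    have h2 : s(v, b) ∉ F := fun h => hvE b (hFs _ h n3)
    rw [← sum_reroute hab habF h1 h2]
    refine hF _ ?_ ⟨_, Finset.mem_insert_self _ _⟩ (he.reroute hva.ne hvb.ne hab habF h1 h2)
    intro e he
    rw [hE]
    simp only [Finset.mem_insert, Finset.mem_erase] at he ⊢
    rcases he with h | h | h
    exacts [Or.inl h, Or.inr (Or.inl h), Or.inr (Or.inr (hFs e h.2 h.1))]
  by_cases hG : G.Adj a b
  · have habE : s(a, b) ∈ edgesIn G (S.erase v) := mk_mem_edgesIn.2 ⟨haS', hbS', hG⟩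
    have htri : 1 ≤ w s(v, a) + (w s(v, b) + w s(a, b)) := by
      have := hF {s(v, a), s(v, b), s(a, b)} (by
        intro e he
        simp only [Finset.mem_insert, Finset.mem_singleton] at he
        rcases he with rfl | rfl | rfl
        exacts [hvaE, hvbE, hsub habE]) ⟨_, Finset.mem_insert_self _ _⟩
        (isEvenSet_triangle hva.ne hvb.ne hab)
      rwa [Finset.sum_insert (by simp [n1, n2]), Finset.sum_pair n3] at this
    by_cases hex' : ∃ F ⊆ edgesIn G (S.erase v), F.Nonempty ∧ IsEvenSet F
    · have hsum' : ∀ F : Finset (Sym2 V), s(a, b) ∈ F →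
          ∑ e ∈ F, Function.update w s(a, b) (min (w s(a, b)) (w s(v, a) + w s(v, b))) e =
          ∑ e ∈ F, w e - w s(a, b) + min (w s(a, b)) (w s(v, a) + w s(v, b)) := by
        intro F hF
        rw [Finset.sum_update_of_mem hF, ← Finset.erase_eq, ← Finset.add_sum_erase F w hF]
        ring
      have key := ih _ (Finset.erase_ssubset hv) G
        (Function.update w s(a, b) (min (w s(a, b)) (w s(v, a) + w s(v, b)))) hpl ?_ ?_ hex'
      · rw [hsum' _ habE] at key
        have : 2 * min (w s(a, b)) (w s(v, a) + w s(v, b)) + 1 ≤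
            2 * (w s(a, b) + (w s(v, a) + w s(v, b))) := by
          rcases le_total (w s(a, b)) (w s(v, a) + w s(v, b)) with h | h
          · rw [min_eq_left h]
            linarith
          · rw [min_eq_right h]
            linarith
        linarith
      · intro e
        by_cases he : e = s(a, b)
        · subst he
          rw [Function.update_self]
          exact le_min (hw _) (add_nonneg (hw _) (hw _))
        · rw [Function.update_of_ne he]
          exact hw e
      · intro F hFs hne he
        have hFS := hF F (hFs.trans hsub) hne he
        by_cases habF : s(a, b) ∈ F
        · rw [hsum' F habF]
          have := reroute F (fun e h _ => hFs h) he habF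
          rcases le_total (w s(a, b)) (w s(v, a) + w s(v, b)) with h | h
          · rw [min_eq_left h]
            linarith
          · rw [min_eq_right h]
            linarith
        · rwa [Finset.sum_update_of_notMem habF]
    · have := card_edgesIn_lt_of_no_even (G := G) ⟨a, haS'⟩ subset_rfl
        (fun F hFs hne he => hex' ⟨F, hFs, hne, he⟩)
      have : ((edgesIn G (S.erase v)).card : ℝ) + 1 ≤ (S.erase v).card := by exact_mod_cast this
      linarith
  · have habE : s(a, b) ∉ edgesIn G (S.erase v) := fun h => hG (mk_mem_edgesIn.1 h).2.2
    have hE' : edgesIn (contractPath G v hab) (S.erase v) =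
        insert s(a, b) (edgesIn G (S.erase v)) := by
      ext e
      induction e with | _ x y
      simp only [mk_mem_edgesIn, Finset.mem_insert, contractPath, Sym2.eq_iff]
      constructor
      · rintro ⟨hx, hy, h | h⟩
        exacts [Or.inr ⟨hx, hy, h.1⟩, Or.inl h]
      · rintro (h | h)
        · refine ⟨?_, ?_, Or.inr h⟩ <;> rcases h with ⟨rfl, rfl⟩ | ⟨rfl, rfl⟩ <;> assumption
        · exact ⟨h.1, h.2.1, Or.inl ⟨h.2.2, Finset.ne_of_mem_erase h.1,
            Finset.ne_of_mem_erase h.2.1⟩⟩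
    have hsum' : ∀ F : Finset (Sym2 V), s(a, b) ∈ F →
        ∑ e ∈ F, Function.update w s(a, b) (w s(v, a) + w s(v, b)) e =
        ∑ e ∈ F, w e - w s(a, b) + (w s(v, a) + w s(v, b)) := by
      intro F hF
      rw [Finset.sum_update_of_mem hF, ← Finset.erase_eq, ← Finset.add_sum_erase F w hF]
      ring
    have key := ih _ (Finset.erase_ssubset hv) (contractPath G v hab)
      (Function.update w s(a, b) (w s(v, a) + w s(v, b))) (hpl.contractPath hab hva hvb) ?_ ?_ ?_
    · rw [hE', hsum' _ (Finset.mem_insert_self _ _), Finset.card_insert_of_notMem habE,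
        Finset.sum_insert habE] at key
      push_cast at key
      linarith
    · intro e
      by_cases he : e = s(a, b)
      · subst he
        rw [Function.update_self]
        exact add_nonneg (hw _) (hw _)
      · rw [Function.update_of_ne he]
        exact hw e
    · intro F hFs hne he
      rw [hE'] at hFs
      have hFs' : ∀ e ∈ F, e ≠ s(a, b) → e ∈ edgesIn G (S.erase v) := fun e h hn =>
        (Finset.mem_insert.1 (hFs h)).resolve_left hn
      by_cases habF : s(a, b) ∈ F
      · rw [hsum' F habF]
        exact reroute F hFs' he habF
      · rw [Finset.sum_update_of_notMem habF]
        exact hF F (fun e h => hsub (hFs' e h fun h' => habF (h' ▸ h))) hne he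
    · obtain ⟨F, hFs, hne, he⟩ := hex
      have habF : s(a, b) ∉ F := fun h => hG (mk_mem_edgesIn.1 (hFs h)).2.2
      have hcase : ∀ x y, s(v, x) ∈ F → s(v, y) ∉ F → F.filter (v ∈ ·) ⊆ {s(v, a), s(v, b)} →
          ({s(v, a), s(v, b)} : Finset (Sym2 V)) = {s(v, x), s(v, y)} → False := by
        intro x y hx hy hs hxy
        have : F.filter (v ∈ ·) = {s(v, x)} := by
          ext e
          rw [Finset.mem_filter, Finset.mem_singleton]
          constructor
          · rintro ⟨h1, h2⟩
            have := hs (Finset.mem_filter.2 ⟨h1, h2⟩)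
            rw [hxy, Finset.mem_insert, Finset.mem_singleton] at this
            exact this.resolve_right fun h => hy (h ▸ h1)
          · rintro rfl
            exact ⟨hx, by simp⟩
        have h := he v
        rw [this] at h
        simp at h
      have hs : F.filter (v ∈ ·) ⊆ {s(v, a), s(v, b)} := by
        intro e h
        obtain ⟨h1, h2⟩ := Finset.mem_filter.1 h
        have := hFs h1
        rw [hE, Finset.mem_insert, Finset.mem_insert] at this
        rw [Finset.mem_insert, Finset.mem_singleton]
        rcases this with h | h | h
        · exact Or.inl h
        · exact Or.inr h
        · rw [edgesIn_erase, Finset.mem_filter] at h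
          exact absurd h2 h.2
      have hiff : s(v, a) ∈ F ↔ s(v, b) ∈ F := by
        constructor
        · intro h
          by_contra h'
          exact hcase a b h h' hs rfl
        · intro h
          by_contra h'
          exact hcase b a h h' hs (Finset.pair_comm _ _)
      rw [hE']
      by_cases h : s(v, a) ∈ F
      · refine ⟨_, ?_, ⟨_, Finset.mem_insert_self _ _⟩,
          he.shortcut hva.ne hvb.ne hab habF h (hiff.1 h)⟩
        refine Finset.insert_subset_insert _ fun e h => ?_
        rw [Finset.mem_erase, Finset.mem_erase] at h
        have := hFs h.2.2
        rw [hE, Finset.mem_insert, Finset.mem_insert] at this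
        exact (this.resolve_left h.2.1).resolve_left h.1
      · refine ⟨F, fun e heF => ?_, hne, he⟩
        have := hFs heF
        rw [hE, Finset.mem_insert, Finset.mem_insert] at this
        rcases this with rfl | rfl | h'
        · exact absurd heF h
        · exact absurd (hiff.2 heF) h
        · exact Finset.mem_insert_of_mem h'

end Euler

section EulerSeparation

open scoped Classical

variable {V : Type} {G : SimpleGraph V}

/-- The edges of `G` inside `S` that meet `Y`. -/
noncomputable def edgesMeeting (G : SimpleGraph V) (S Y : Finset V) : Finset (Sym2 V) :=
  (edgesIn G S).filter fun e => ∃ v ∈ Y, v ∈ e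

theorem mk_mem_edgesMeeting {S Y : Finset V} {u v : V} :
    s(u, v) ∈ edgesMeeting G S Y ↔ (u ∈ S ∧ v ∈ S ∧ G.Adj u v) ∧ (u ∈ Y ∨ v ∈ Y) := by
  rw [edgesMeeting, Finset.mem_filter, mk_mem_edgesIn]
  refine and_congr_right fun _ => ?_
  simp only [Sym2.mem_iff]
  constructor
  · rintro ⟨w, hw, rfl | rfl⟩
    exacts [Or.inl hw, Or.inr hw]
  · rintro (h | h)
    exacts [⟨u, h, Or.inl rfl⟩, ⟨v, h, Or.inr rfl⟩]

theorem edgesMeeting_subset {S Y X : Finset V}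
    (hN : ∀ y ∈ Y, ∀ v ∈ S, G.Adj y v → v ∈ Y ∪ X) :
    edgesMeeting G S Y ⊆ edgesIn G (Y ∪ X) := by
  intro e
  induction e with | _ u v
  rw [mk_mem_edgesMeeting, mk_mem_edgesIn]
  rintro ⟨⟨hu, hv, huv⟩, h | h⟩
  · exact ⟨Finset.mem_union_left _ h, hN u h v hv huv, huv⟩
  · exact ⟨hN v h u hu huv.symm, Finset.mem_union_left _ h, huv⟩

/-- A set of vertices of degree at least three with at most two outer neighbors meets a cycle. -/
theorem exists_isEvenSet_meeting [Fintype V] {S Y X : Finset V} (hY : Y ⊆ S) (hne : Y.Nonempty)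
    (hX : X.card ≤ 2) (hdeg : ∀ v ∈ Y, 3 ≤ (S.filter (G.Adj v)).card)
    (hN : ∀ y ∈ Y, ∀ v ∈ S, G.Adj y v → v ∈ Y ∪ X) :
    ∃ F ⊆ edgesMeeting G S Y, F.Nonempty ∧ IsEvenSet F := by
  by_contra hcon
  push Not at hcon
  have hsub := edgesMeeting_subset hN
  have h1 := card_edgesIn_lt_of_no_even (hne.mono Finset.subset_union_left) hsub hcon
  have hsub' : edgesIn G Y ⊆ edgesMeeting G S Y := by
    intro e
    induction e with | _ u v
    rw [mk_mem_edgesMeeting, mk_mem_edgesIn]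
    exact fun h => ⟨⟨hY h.1, hY h.2.1, h.2.2⟩, Or.inl h.1⟩
  have h2 := card_edgesIn_lt_of_no_even (G := G) hne subset_rfl
    fun F hF => hcon F (hF.trans hsub')
  have h3 : Y.card * 3 ≤ ∑ y ∈ Y, ((edgesMeeting G S Y).filter (y ∈ ·)).card := by
    rw [← smul_eq_mul, ← Finset.sum_const]
    refine Finset.sum_le_sum fun y hy => (hdeg y hy).trans ?_
    rw [← card_edgesIn_filter_mem (hY hy)]
    refine Finset.card_le_card fun e he => ?_
    rw [Finset.mem_filter] at he ⊢
    exact ⟨Finset.mem_filter.2 ⟨he.1, y, hy, he.2⟩, he.2⟩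
  have h4 : ∑ y ∈ Y, ((edgesMeeting G S Y).filter (y ∈ ·)).card
      = ∑ e ∈ edgesMeeting G S Y, (Y.filter (· ∈ e)).card :=
    Finset.sum_card_bipartiteAbove_eq_sum_card_bipartiteBelow (fun y e => y ∈ e)
  have h5 : ∑ e ∈ edgesMeeting G S Y, (Y.filter (· ∈ e)).card
      ≤ ∑ e ∈ edgesMeeting G S Y, (1 + if e ∈ edgesIn G Y then 1 else 0) := by
    refine Finset.sum_le_sum fun e he => ?_
    induction e with | _ u v
    obtain ⟨⟨-, -, huv⟩, -⟩ := mk_mem_edgesMeeting.1 he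
    split_ifs with h
    · refine le_trans (Finset.card_le_card (t := {u, v}) fun z hz => ?_) Finset.card_le_two
      simpa using (Finset.mem_filter.1 hz).2
    · rw [add_zero, Finset.card_le_one]
      intro x hx y hy
      rw [Finset.mem_filter, Sym2.mem_iff] at hx hy
      rw [mk_mem_edgesIn] at h
      by_contra hxy
      rcases hx with ⟨hx, rfl | rfl⟩ <;> rcases hy with ⟨hy, rfl | rfl⟩
      exacts [hxy rfl, h ⟨hx, hy, huv⟩, h ⟨hy, hx, huv⟩, hxy rfl]
  rw [Finset.sum_add_distrib, ← Finset.card_eq_sum_ones, ← Finset.card_filter,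
    Finset.filter_mem_eq_inter, Finset.inter_eq_right.2 hsub'] at h5
  have := Finset.card_union_le Y X
  have := hne.card_pos
  omega

/-- The subgraph of the edges meeting `Y`. -/
def meeting (G : SimpleGraph V) (Y : Finset V) : SimpleGraph V where
  Adj u v := G.Adj u v ∧ (u ∈ Y ∨ v ∈ Y)
  symm := ⟨fun _ _ h => ⟨h.1.symm, h.2.symm⟩⟩
  loopless := ⟨fun _ h => G.loopless.irrefl _ h.1⟩

theorem euler_of_separation [Fintype V] {S : Finset V} (ih : ∀ T ⊂ S, EulerBound T)
    {w : Sym2 V → ℝ} (hpl : IsPlanar G) (hw : ∀ e, 0 ≤ w e) (hF : HeavyOn G S w)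
    (hdeg : ∀ v ∈ S, 3 ≤ (S.filter (G.Adj v)).card) (hsep : ¬ NoTwoSep G S) :
    ((edgesIn G S).card : ℝ) - S.card + 2 ≤ 2 * ∑ e ∈ edgesIn G S, w e := by
  rw [NoTwoSep] at hsep
  push Not at hsep
  obtain ⟨Y₀, hY₀, ⟨y, hy⟩, a, b, hN₀, z, hz, hzY, hza, hzb⟩ := hsep
  set Y := Y₀ \ {a, b} with hYdef
  set X := S.filter (· ∈ ({a, b} : Finset V)) with hXdef
  set Z := S \ (Y₀ ∪ {a, b}) with hZdef
  have hYS : Y ⊆ S := Finset.sdiff_subset.trans hY₀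
  have hZS : Z ⊆ S := Finset.sdiff_subset
  have hXS : X ⊆ S := Finset.filter_subset _ _
  have hX2 : X.card ≤ 2 := by
    refine le_trans (Finset.card_le_card (t := {a, b}) fun v hv => ?_) Finset.card_le_two
    exact (Finset.mem_filter.1 hv).2
  have hYne : Y.Nonempty := by
    by_contra h
    rw [Finset.not_nonempty_iff_eq_empty, hYdef, Finset.sdiff_eq_empty_iff_subset] at h
    have : S.filter (G.Adj y) ⊆ {a, b} := fun v hv => by
      rw [Finset.mem_filter] at hv
      rcases hN₀ y hy v hv.1 hv.2 with h' | h' | h'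
      exacts [h h', by simp [h'], by simp [h']]
    have := Finset.card_le_card this
    have := hdeg y (hY₀ hy)
    have := Finset.card_le_two (a := a) (b := b)
    omega
  have hNY : ∀ y ∈ Y, ∀ v ∈ S, G.Adj y v → v ∈ Y ∪ X := by
    intro y hy v hv hyv
    have := hN₀ y (Finset.mem_sdiff.1 hy).1 v hv hyv
    simp only [hYdef, hXdef, Finset.mem_union, Finset.mem_sdiff, Finset.mem_filter,
      Finset.mem_insert, Finset.mem_singleton]
    tauto
  have hZY : ∀ z ∈ Z, ∀ v ∈ Y₀, ¬ G.Adj z v := by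
    intro z hz v hv hzv
    simp only [hZdef, Finset.mem_union, Finset.mem_sdiff, Finset.mem_insert,
      Finset.mem_singleton] at hz
    have := hN₀ v hv z hz.1 hzv.symm
    tauto
  have hNZ : ∀ y ∈ Z, ∀ v ∈ S, G.Adj y v → v ∈ Z ∪ X := by
    intro y hy v hv hyv
    have := fun h => hZY y hy v h hyv
    simp only [hZdef, hXdef, Finset.mem_union, Finset.mem_sdiff, Finset.mem_filter,
      Finset.mem_insert, Finset.mem_singleton]
    tauto
  have hzZ : z ∈ Z := by simp [hZdef, hz, hzY, hza, hzb]
  obtain ⟨F₁, hF₁, hne₁, he₁⟩ :=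
    exists_isEvenSet_meeting hYS hYne hX2 (fun v hv => hdeg v (hYS hv)) hNY
  obtain ⟨F₂, hF₂, hne₂, he₂⟩ :=
    exists_isEvenSet_meeting hZS ⟨z, hzZ⟩ hX2 (fun v hv => hdeg v (hZS hv)) hNZ
  have hE₁ : edgesIn (meeting G Y) (Y ∪ X) = (edgesIn G S).filter fun e => ∃ v ∈ Y, v ∈ e := by
    ext e
    induction e with | _ u v
    rw [← edgesMeeting, mk_mem_edgesMeeting, mk_mem_edgesIn]
    constructor
    · rintro ⟨hu, hv, huv, h⟩
      exact ⟨⟨Finset.union_subset hYS hXS hu, Finset.union_subset hYS hXS hv, huv⟩, h⟩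
    · intro h
      have := mk_mem_edgesIn.1 (edgesMeeting_subset hNY (mk_mem_edgesMeeting.2 h))
      exact ⟨this.1, this.2.1, this.2.2, h.2⟩
  have hE₂ : edgesIn G (S \ Y) = (edgesIn G S).filter fun e => ¬ ∃ v ∈ Y, v ∈ e := by
    ext e
    induction e with | _ u v
    rw [Finset.mem_filter, mk_mem_edgesIn, mk_mem_edgesIn, Finset.mem_sdiff (s := S) (t := Y), Finset.mem_sdiff (s := S) (t := Y)]
    constructor
    · rintro ⟨⟨h1, h2⟩, ⟨h3, h4⟩, h5⟩
      refine ⟨⟨h1, h3, h5⟩, ?_⟩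
      rintro ⟨w, hw, hwe⟩
      rcases Sym2.mem_iff.1 hwe with rfl | rfl
      exacts [h2 hw, h4 hw]
    · rintro ⟨⟨h1, h3, h5⟩, h⟩
      exact ⟨⟨h1, fun h' => h ⟨u, h', by simp⟩⟩, ⟨h3, fun h' => h ⟨v, h', by simp⟩⟩, h5⟩
  have hs₁ : Y ∪ X ⊂ S := by
    refine Finset.ssubset_iff_subset_ne.2 ⟨Finset.union_subset hYS hXS, fun h => ?_⟩
    rw [← h] at hz
    simp [hYdef, hXdef, hzY, hza, hzb] at hz
  have hs₂ : S \ Y ⊂ S := Finset.sdiff_ssubset hYS hYne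
  have k₁ := ih _ hs₁ (meeting G Y) w (hpl.mono fun u v h => h.1) hw
    (fun F hF' => hF F (hF'.trans (hE₁ ▸ Finset.filter_subset _ _)))
    ⟨F₁, by rw [hE₁]; exact hF₁, hne₁, he₁⟩
  have k₂ := ih _ hs₂ G w hpl hw (fun F hF' => hF F (hF'.trans (edgesIn_mono hs₂.subset)))
    ⟨F₂, fun e he => by
      have hm := hF₂ he
      induction e with | _ u v
      rw [mk_mem_edgesMeeting] at hm
      rw [mk_mem_edgesIn, Finset.mem_sdiff (s := S) (t := Y), Finset.mem_sdiff (s := S) (t := Y)]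
      obtain ⟨⟨hu, hv, huv⟩, h⟩ := hm
      have hY' : ∀ v ∈ Y, v ∈ Y₀ := fun v hv => (Finset.mem_sdiff.1 hv).1
      have hZ' : ∀ v ∈ Z, v ∉ Y₀ := fun v hv h =>
        (Finset.mem_sdiff.1 hv).2 (Finset.mem_union_left _ h)
      rcases h with h | h
      · exact ⟨⟨hu, fun h' => hZ' u h (hY' u h')⟩, ⟨hv, fun h' => hZY u h v (hY' v h') huv⟩, huv⟩
      · exact ⟨⟨hu, fun h' => hZY v h u (hY' u h') huv.symm⟩, ⟨hv, fun h' => hZ' v h (hY' v h')⟩,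
          huv⟩, hne₂, he₂⟩
  rw [hE₁] at k₁
  rw [hE₂] at k₂
  have c₁ : ((edgesIn G S).card : ℝ) = ((edgesIn G S).filter fun e => ∃ v ∈ Y, v ∈ e).card +
      ((edgesIn G S).filter fun e => ¬ ∃ v ∈ Y, v ∈ e).card := by
    exact_mod_cast (Finset.card_filter_add_card_filter_not _).symm
  have c₂ := Finset.sum_filter_add_sum_filter_not (edgesIn G S) (fun e => ∃ v ∈ Y, v ∈ e) w
  have c₃ : ((Y ∪ X).card : ℝ) + (S \ Y).card ≤ S.card + 2 := by
    have h1 := Finset.card_union_le Y X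
    have h2 := Finset.card_sdiff_add_card_eq_card hYS
    have : (Y ∪ X).card + (S \ Y).card ≤ S.card + 2 := by omega
    exact_mod_cast this
  linarith

theorem eulerBound [Fintype V] (S : Finset V) : EulerBound S := by
  induction S using Finset.strongInduction with
  | H S ih =>
    intro G w hpl hw hF hex
    by_cases hdeg : ∀ v ∈ S, 3 ≤ (S.filter (G.Adj v)).card
    · by_cases hsep : NoTwoSep G S
      · refine hpl.card_edgesIn_le_weight ?_ hdeg hsep hF
        obtain ⟨F, hFs, ⟨e, he⟩, -⟩ := hex
        induction e with | _ u v
        exact ⟨u, (mk_mem_edgesIn.1 (hFs he)).1⟩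
      · exact euler_of_separation ih hpl hw hF hdeg hsep
    · push Not at hdeg
      obtain ⟨v, hv, hd⟩ := hdeg
      rcases Nat.lt_or_ge (S.filter (G.Adj v)).card 2 with h | h
      · exact euler_of_degree_le_one ih hpl hw hF hex hv (Nat.lt_succ_iff.1 h)
      · exact euler_of_degree_two ih hpl hw hF hex hv (le_antisymm (Nat.lt_succ_iff.1 hd) h)

end EulerSeparation

section Girth

open scoped Classical

variable {V : Type} {G : SimpleGraph V}

/-- A nonempty even set of edges contains a cycle. -/
theorem IsEvenSet.exists_cycle [Fintype V] {F : Finset (Sym2 V)} (hFG : ∀ e ∈ F, e ∈ G.edgeSet)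
    (hne : F.Nonempty) (he : IsEvenSet F) :
    ∃ (v : V) (c : G.Walk v v), c.IsCycle ∧ c.length ≤ F.card := by
  let H : SimpleGraph V := SimpleGraph.fromEdgeSet (F : Set (Sym2 V))
  have hHF : H.edgeSet ⊆ F := by
    rw [SimpleGraph.edgeSet_fromEdgeSet]
    exact Set.sdiff_subset
  have hHG : H ≤ G := SimpleGraph.edgeSet_subset_edgeSet.1 fun e h => hFG e (hHF h)
  have hcyc : ¬ H.IsAcyclic := by
    intro hac
    obtain ⟨e, heF⟩ := hne
    induction e with | _ u v
    have huv : u ≠ v := ((SimpleGraph.mem_edgeSet G).1 (hFG _ heF)).ne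
    have hH : H.Adj u v := (SimpleGraph.fromEdgeSet_adj _).2 ⟨heF, huv⟩
    have hb := SimpleGraph.isAcyclic_iff_forall_adj_isBridge.1 hac hH
    rw [SimpleGraph.isBridge_iff] at hb
    set H' := H.deleteEdges {s(u, v)} with hH'
    have hsum := he.sum_coboundary_eq_zero fun x => if H'.Reachable u x then 1 else 0
    rw [Finset.sum_eq_single_of_mem _ heF, coboundary_mk _ huv, if_pos (SimpleGraph.Reachable.refl u),
      if_neg hb] at hsum
    · simp at hsum
    · intro e heF' hne
      induction e with | _ x y
      have hxy : x ≠ y := ((SimpleGraph.mem_edgeSet G).1 (hFG _ heF')).ne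
      have hadj : H'.Adj x y := by
        rw [hH', SimpleGraph.deleteEdges_adj, SimpleGraph.fromEdgeSet_adj]
        exact ⟨⟨heF', hxy⟩, fun h => hne h⟩
      have hiff : H'.Reachable u x ↔ H'.Reachable u y :=
        ⟨fun h => h.trans hadj.reachable, fun h => h.trans hadj.symm.reachable⟩
      rw [coboundary_mk _ hxy]
      simp only [hiff]
      exact CharTwo.add_self_eq_zero _
  rw [SimpleGraph.IsAcyclic] at hcyc
  push Not at hcyc
  obtain ⟨v, c, hc⟩ := hcyc
  refine ⟨v, c.mapLe hHG, hc.mapLe hHG, ?_⟩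
  rw [SimpleGraph.Walk.length_map, ← SimpleGraph.Walk.length_edges,
    ← List.toFinset_card_of_nodup hc.isCircuit.isTrail.edges_nodup]
  refine Finset.card_le_card fun e h => ?_
  rw [List.mem_toFinset] at h
  exact hHF (c.edges_subset_edgeSet h)

theorem IsEvenSet.le_card_of_egirth [Fintype V] (hg : (6 : ℕ∞) ≤ G.egirth) {F : Finset (Sym2 V)}
    (hFG : ∀ e ∈ F, e ∈ G.edgeSet) (hne : F.Nonempty) (he : IsEvenSet F) : 6 ≤ F.card := by
  obtain ⟨v, c, hc, hle⟩ := he.exists_cycle hFG hne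
  have := SimpleGraph.le_egirth.1 hg v c hc
  have : 6 ≤ c.length := by exact_mod_cast this
  omega

/-- Planar graphs of girth at least six are sparse. -/
theorem IsPlanar.two_mul_card_edgesIn_lt [Fintype V] {H : SimpleGraph V} (hpl : IsPlanar H)
    (hHG : H ≤ G) (hg : (6 : ℕ∞) ≤ G.egirth) {S : Finset V} (hS : S.Nonempty) :
    2 * (edgesIn H S).card < 3 * S.card := by
  by_cases hex : ∃ F ⊆ edgesIn H S, F.Nonempty ∧ IsEvenSet F
  · have key := eulerBound S H (fun _ => 1 / 6) hpl (fun _ => by norm_num) (by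
      intro F hF hne he
      have : (6 : ℝ) ≤ F.card := by
        exact_mod_cast he.le_card_of_egirth hg (fun e heF =>
          SimpleGraph.edgeSet_mono hHG (Finset.mem_filter.1 (hF heF)).2) hne
      rw [Finset.sum_const, nsmul_eq_mul]
      linarith) hex
    rw [Finset.sum_const, nsmul_eq_mul] at key
    have : (2 * (edgesIn H S).card : ℝ) < 3 * S.card := by linarith
    exact_mod_cast this
  · have := card_edgesIn_lt_of_no_even (G := H) hS subset_rfl
      fun F hF hne he => hex ⟨F, hF, hne, he⟩
    omega

end Girth

section OddColoring

open scoped Classical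

variable {V : Type} {G : SimpleGraph V}

theorem IsMinor.exists_distinct_edges {W : Type} {H : SimpleGraph W} (h : IsMinor H G)
    {a b c d : W} (hab : H.Adj a b) (hcd : H.Adj c d) (hca : c ≠ a) (hcb : c ≠ b) :
    ∃ x y z w, G.Adj x y ∧ G.Adj z w ∧ s(x, y) ≠ s(z, w) := by
  obtain ⟨B, -, -, hdisj, hadj⟩ := h
  obtain ⟨x, hx, y, hy, hxy⟩ := hadj a b hab
  obtain ⟨z, hz, w, -, hzw⟩ := hadj c d hcd
  refine ⟨x, y, z, w, hxy, hzw, fun he => ?_⟩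
  have : z ∈ s(x, y) := he ▸ Sym2.mem_mk_left z w
  rcases Sym2.mem_iff.1 this with rfl | rfl
  · exact Set.disjoint_left.1 (hdisj hca) hz hx
  · exact Set.disjoint_left.1 (hdisj hcb) hz hy

theorem isPlanar_of_subsingleton_edges
    (h : ∀ x y z w, G.Adj x y → G.Adj z w → s(x, y) = s(z, w)) : IsPlanar G := by
  constructor
  · intro hm
    obtain ⟨x, y, z, w, hxy, hzw, hne⟩ := hm.exists_distinct_edges (a := 0) (b := 1) (c := 2)
      (d := 3) (by simp) (by simp) (by decide) (by decide)
    exact hne (h x y z w hxy hzw)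
  · intro hm
    obtain ⟨x, y, z, w, hxy, hzw, hne⟩ := hm.exists_distinct_edges (a := Sum.inl 0)
      (b := Sum.inr 0) (c := Sum.inl 1) (d := Sum.inr 1) (by simp) (by simp) (by simp) (by simp)
    exact hne (h x y z w hxy hzw)

theorem thicknessLE_thickness [Fintype V] (G : SimpleGraph V) : ThicknessLE G (thickness G) := by
  refine Nat.sInf_mem (s := {t | ThicknessLE G t})
    ⟨Fintype.card (Sym2 V), Fintype.equivFin (Sym2 V), fun i => ?_⟩
  refine isPlanar_of_subsingleton_edges fun x y z w hxy hzw => ?_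
  rw [SimpleGraph.fromEdgeSet_adj] at hxy hzw
  exact (Fintype.equivFin (Sym2 V)).injective (hxy.1.2.trans hzw.1.2.symm)

theorem ThicknessLE.two_mul_card_edgesIn_lt [Fintype V] {t : ℕ} (h : ThicknessLE G t) (ht : 0 < t)
    (hg : (6 : ℕ∞) ≤ G.egirth) {S : Finset V} (hS : S.Nonempty) :
    2 * (edgesIn G S).card < 3 * t * S.card := by
  obtain ⟨c, hc⟩ := h
  have h1 : (edgesIn G S).card = ∑ i : Fin t, ((edgesIn G S).filter (c · = i)).card :=
    Finset.card_eq_sum_card_fiberwise fun _ _ => Finset.mem_coe.2 (Finset.mem_univ _)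
  have h2 : ∀ i : Fin t, (edgesIn G S).filter (c · = i) =
      edgesIn (SimpleGraph.fromEdgeSet {e | e ∈ G.edgeSet ∧ c e = i}) S := by
    intro i
    ext e
    induction e with | _ u v
    rw [Finset.mem_filter, mk_mem_edgesIn, mk_mem_edgesIn, SimpleGraph.fromEdgeSet_adj]
    simp only [Set.mem_ofPred_eq, SimpleGraph.mem_edgeSet]
    exact ⟨fun h => ⟨h.1.1, h.1.2.1, ⟨h.1.2.2, h.2⟩, h.1.2.2.ne⟩,
      fun h => ⟨⟨h.1, h.2.1, h.2.2.1.1⟩, h.2.2.1.2⟩⟩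
  have h3 : ∑ i : Fin t, 2 * ((edgesIn G S).filter (c · = i)).card < ∑ _i : Fin t, 3 * S.card := by
    refine Finset.sum_lt_sum_of_nonempty ⟨⟨0, ht⟩, Finset.mem_univ _⟩ fun i _ => ?_
    rw [h2]
    refine (hc i).two_mul_card_edgesIn_lt (fun u v huv => ?_) hg hS
    exact ((SimpleGraph.fromEdgeSet_adj _).1 huv).1.1
  rw [← Finset.mul_sum, ← h1, Finset.sum_const, Finset.card_univ, Fintype.card_fin,
    smul_eq_mul] at h3
  linarith

theorem sum_card_filter_adj (S : Finset V) :
    ∑ v ∈ S, (S.filter (G.Adj v)).card = 2 * (edgesIn G S).card := by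
  rw [Finset.sum_congr rfl fun v hv => (card_edgesIn_filter_mem hv).symm]
  refine (Finset.sum_card_bipartiteAbove_eq_sum_card_bipartiteBelow (fun v e => v ∈ e)).trans ?_
  rw [mul_comm, ← smul_eq_mul, ← Finset.sum_const]
  refine Finset.sum_congr rfl fun e he => ?_
  induction e with | _ u v
  obtain ⟨hu, hv, huv⟩ := mk_mem_edgesIn.1 he
  rw [← Finset.card_pair huv.ne]
  congr 1
  ext z
  simp only [Finset.mem_bipartiteBelow, Sym2.mem_iff, Finset.mem_insert, Finset.mem_singleton]
  constructor
  · exact fun h => h.2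
  · rintro (rfl | rfl) <;> simp [*]

theorem sum_card_filter_adj_comm (S A : Finset V) :
    ∑ v ∈ S, (A.filter (G.Adj v)).card = ∑ v ∈ A, (S.filter (G.Adj v)).card := by
  refine (Finset.sum_card_bipartiteAbove_eq_sum_card_bipartiteBelow G.Adj).trans ?_
  refine Finset.sum_congr rfl fun v _ => ?_
  congr 1
  ext z
  simp [Finset.mem_bipartiteBelow, G.adj_comm]

/-- Sparse graphs of large minimum degree have a vertex at which a greedy coloring can be
extended. -/
theorem exists_mem_card_add_card_lt [Fintype V] {t : ℕ}
    (hsparse : ∀ S : Finset V, S.Nonempty → 2 * (edgesIn G S).card < 3 * t * S.card)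
    (hδ : ∀ v, 2 * t - 1 ≤ (Finset.univ.filter (G.Adj v)).card) {S : Finset V} (hS : S.Nonempty) :
    ∃ u ∈ S, (S.filter (G.Adj u)).card + (Finset.univ.filter fun v => G.Adj u v ∧
      Even (Finset.univ.filter (G.Adj v)).card ∧ ∀ x, G.Adj v x → x ∈ S).card < 6 * t := by
  by_contra hcon
  push Not at hcon
  set P := Finset.univ.filter fun v => Even (Finset.univ.filter (G.Adj v)).card ∧
    ∀ x, G.Adj v x → x ∈ S with hP
  have hPu : ∀ u, (Finset.univ.filter fun v => G.Adj u v ∧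
      Even (Finset.univ.filter (G.Adj v)).card ∧ ∀ x, G.Adj v x → x ∈ S) = P.filter (G.Adj u) := by
    intro u
    ext v
    simp only [hP, Finset.mem_filter, Finset.mem_univ, true_and]
    exact and_comm
  have h1 := Finset.sum_le_sum hcon
  simp only [hPu] at h1
  rw [Finset.sum_const, smul_eq_mul, Finset.sum_add_distrib, sum_card_filter_adj,
    sum_card_filter_adj_comm] at h1
  set A := P \ S with hA
  have hdisj : Disjoint S A := Finset.disjoint_sdiff
  have h2 : ∑ v ∈ P, (S.filter (G.Adj v)).card ≤
      2 * (edgesIn G S).card + ∑ v ∈ A, (S.filter (G.Adj v)).card := by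
    rw [← Finset.sum_inter_add_sum_sdiff P S, ← sum_card_filter_adj S]
    refine Nat.add_le_add_right (Finset.sum_le_sum_of_subset Finset.inter_subset_right) _
  have h3 : A.card * (2 * t) ≤ ∑ v ∈ A, (S.filter (G.Adj v)).card := by
    rw [← smul_eq_mul, ← Finset.sum_const]
    refine Finset.sum_le_sum fun v hv => ?_
    obtain ⟨-, ⟨k, hk⟩, hN⟩ := Finset.mem_filter.1 (Finset.mem_sdiff.1 hv).1
    have : S.filter (G.Adj v) = Finset.univ.filter (G.Adj v) := by
      ext x
      simp only [Finset.mem_filter, Finset.mem_univ, true_and]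
      exact ⟨fun h => h.2, fun h => ⟨hN x h, h⟩⟩
    rw [this]
    have := hδ v
    omega
  have h4 : ∀ v, ((S ∪ A).filter (G.Adj v)).card =
      (S.filter (G.Adj v)).card + (A.filter (G.Adj v)).card := fun v => by
    rw [Finset.filter_union, Finset.card_union_of_disjoint]
    exact Finset.disjoint_filter_filter hdisj
  have h5 := sum_card_filter_adj (G := G) (S ∪ A)
  rw [Finset.sum_union hdisj, Finset.sum_congr rfl fun v _ => h4 v,
    Finset.sum_congr (s₁ := A) rfl fun v _ => h4 v, Finset.sum_add_distrib,
    Finset.sum_add_distrib, sum_card_filter_adj, sum_card_filter_adj_comm S A] at h5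
  have h6 := hsparse (S ∪ A) (hS.mono Finset.subset_union_left)
  rw [Finset.card_union_of_disjoint hdisj] at h6
  generalize ∑ v ∈ A, (A.filter (G.Adj v)).card = y at h5
  nlinarith

theorem exists_odd_fiber {k : ℕ} {s : Finset V} (φ : V → Fin k) (hs : Odd s.card) :
    ∃ c, Odd (s.filter (φ · = c)).card := by
  by_contra h
  simp only [not_exists, Nat.not_odd_iff_even] at h
  rw [Finset.card_eq_sum_card_fiberwise (f := φ) (t := Finset.univ)
    fun _ _ => Finset.mem_coe.2 (Finset.mem_univ _)] at hs
  exact Nat.not_even_iff_odd.2 hs (Finset.even_sum _ fun c _ => h c)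

/-- The greedy algorithm for odd colorings. -/
theorem exists_isOddColoring [Fintype V] {k : ℕ} (hk : 0 < k)
    (h : ∀ S : Finset V, S.Nonempty → ∃ u ∈ S, (S.filter (G.Adj u)).card +
      (Finset.univ.filter fun v => G.Adj u v ∧ Even (Finset.univ.filter (G.Adj v)).card ∧
        ∀ x, G.Adj v x → x ∈ S).card < k) :
    ∃ φ : V → Fin k, IsOddColoring G φ := by
  have key : ∀ S : Finset V, ∃ φ : V → Fin k, (∀ u ∈ S, ∀ v ∈ S, G.Adj u v → φ u ≠ φ v) ∧
      ∀ v, Even (Finset.univ.filter (G.Adj v)).card → (∃ x, G.Adj v x) →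
        (∀ x, G.Adj v x → x ∈ S) →
        ∃ c, Odd ((Finset.univ.filter (G.Adj v)).filter (φ · = c)).card := by
    intro S
    induction S using Finset.strongInduction with
    | H S ih =>
      rcases S.eq_empty_or_nonempty with rfl | hS
      · refine ⟨fun _ => ⟨0, hk⟩, by simp, fun v _ ⟨x, hx⟩ hN => ?_⟩
        simpa using hN x hx
      · obtain ⟨u, hu, hlt⟩ := h S hS
        obtain ⟨φ, hφ, hodd⟩ := ih _ (Finset.erase_ssubset hu)
        set P := Finset.univ.filter fun v => G.Adj u v ∧
          Even (Finset.univ.filter (G.Adj v)).card ∧ ∀ x, G.Adj v x → x ∈ S with hP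
        have hc : ∀ v, ∃ c, v ∈ P →
            Odd (((Finset.univ.filter (G.Adj v)).erase u).filter (φ · = c)).card := by
          intro v
          by_cases hv : v ∈ P
          · obtain ⟨-, huv, he, -⟩ := Finset.mem_filter.1 hv
            obtain ⟨c, hc⟩ := exists_odd_fiber (s := (Finset.univ.filter (G.Adj v)).erase u) φ (by
              have : u ∈ Finset.univ.filter (G.Adj v) := by simpa using huv.symm
              have h1 := Finset.card_erase_add_one this
              rw [← h1, Nat.even_add_one] at he
              exact Nat.not_even_iff_odd.1 he)
            exact ⟨c, fun _ => hc⟩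
          · exact ⟨⟨0, hk⟩, fun h => absurd h hv⟩
        choose c hc using hc
        obtain ⟨α, hα⟩ : ∃ α, α ∉ (S.filter (G.Adj u)).image φ ∪ P.image c := by
          by_contra hcon
          push Not at hcon
          have h1 := Finset.card_le_card fun (x : Fin k) (_ : x ∈ Finset.univ) => hcon x
          rw [Finset.card_univ, Fintype.card_fin] at h1
          have h2 := Finset.card_union_le ((S.filter (G.Adj u)).image φ) (P.image c)
          have h3 := Finset.card_image_le (s := S.filter (G.Adj u)) (f := φ)
          have h4 := Finset.card_image_le (s := P) (f := c)
          omega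
        rw [Finset.mem_union, not_or] at hα
        have hαφ : ∀ v ∈ S, G.Adj u v → α ≠ φ v := fun v hv huv he =>
          hα.1 (he ▸ Finset.mem_image_of_mem _ (Finset.mem_filter.2 ⟨hv, huv⟩))
        refine ⟨Function.update φ u α, fun x hx y hy hxy => ?_, fun v hev hex hN => ?_⟩
        · by_cases hxu : x = u
          · subst hxu
            rw [Function.update_self, Function.update_of_ne hxy.ne']
            exact hαφ y hy hxy
          · rw [Function.update_of_ne hxu]
            by_cases hyu : y = u
            · subst hyu
              rw [Function.update_self]
              exact (hαφ x hx hxy.symm).symm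
            · rw [Function.update_of_ne hyu]
              exact hφ x (by simp [hx, hxu]) y (by simp [hy, hyu]) hxy
        · by_cases huv : G.Adj u v
          · have hvP : v ∈ P := Finset.mem_filter.2 ⟨Finset.mem_univ _, huv, hev, hN⟩
            refine ⟨c v, ?_⟩
            convert hc v hvP using 2
            ext x
            simp only [Finset.mem_filter, Finset.mem_univ, true_and, Finset.mem_erase]
            by_cases hxu : x = u
            · subst hxu
              rw [Function.update_self]
              have : α ≠ c v := fun he => hα.2 (he ▸ Finset.mem_image_of_mem _ hvP)
              simp [this]
            · rw [Function.update_of_ne hxu]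
              simp [hxu]
          · obtain ⟨d, hd⟩ := hodd v hev hex fun x hx =>
              Finset.mem_erase.2 ⟨fun he => huv (he ▸ hx.symm), hN x hx⟩
            refine ⟨d, ?_⟩
            convert hd using 2
            ext x
            simp only [Finset.mem_filter, Finset.mem_univ, true_and]
            refine and_congr_right fun hx => ?_
            have hxu : x ≠ u := by
              rintro rfl
              exact huv hx.symm
            rw [Function.update_of_ne hxu]
  obtain ⟨φ, hφ, hodd⟩ := key Finset.univ
  refine ⟨φ, fun u v huv => hφ u (Finset.mem_univ _) v (Finset.mem_univ _) huv, fun v hv => ?_⟩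
  obtain ⟨c, hc⟩ : ∃ c, Odd ((Finset.univ.filter (G.Adj v)).filter (φ · = c)).card := by
    rcases Nat.even_or_odd (Finset.univ.filter (G.Adj v)).card with he | ho
    · exact hodd v he hv fun x _ => Finset.mem_univ _
    · exact exists_odd_fiber φ ho
  refine ⟨c, ?_⟩
  rw [← Set.ncard_coe_finset] at hc
  convert hc using 2
  ext x
  simp

end OddColoring

/-- If `δ(G) ≥ 2θ(G) − 1` and `girth(G) ≥ 6`, then `χ_o(G) ≤ 6θ(G)`. -/
theorem oddChrom_le_six_thickness {V : Type} [Fintype V] (G : SimpleGraph V)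
    (hδ : ∀ v : V, 2 * thickness G - 1 ≤ deg G v)
    (hg : (6 : ℕ∞) ≤ G.egirth) :
    oddChrom G ≤ 6 * thickness G := by
  classical
  rcases isEmpty_or_nonempty V with hV | ⟨⟨v₀⟩⟩
  · exact (Nat.sInf_le (s := {k | ∃ φ : V → Fin k, IsOddColoring G φ}) (m := 0)
      ⟨fun v => hV.elim v, fun u => hV.elim u, fun v => hV.elim v⟩).trans
      (Nat.zero_le _)
  have hth := thicknessLE_thickness G
  have ht : 0 < thickness G := by
    obtain ⟨c, -⟩ := hth
    exact Fin.pos (c s(v₀, v₀))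
  refine Nat.sInf_le (exists_isOddColoring (by omega) fun S hS => ?_)
  refine exists_mem_card_add_card_lt (fun T hT => hth.two_mul_card_edgesIn_lt ht hg hT)
    (fun v => ?_) hS
  convert hδ v using 1
  rw [deg, ← Set.ncard_coe_finset]
  congr 1
  ext x
  simp
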